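/- Let u be a weak supersolution of ∂ₜu + 𝓛u = Δu in Ω × (0,T) with u ≥ 0 on B_R(x₀) × (τ₁ − τ, τ₂), where τ > 0, τ₁ − τ < τ₁ < τ₂, and B_R(x₀) × (τ₁ − τ, τ₂) ⊂ Ω × (0,T). Let 0 < r ≤ 1 with r < R, let l > 0, set v = u + l, let m > 0 and put C(m+1) = max{4, (6m + 1)/2}. Then for every nonnegative ψ ∈ C_c^∞(B_r(x₀)) and every nonnegative η ∈ C^∞(ℝ) satisfying η(t) = 0 for t ≤ τ₁ − τ and η(t) = 1 for t ≥ τ₂ one has: ∫_{τ₁−τ}^{τ₂} ∫_{B_r(x₀)} |∇(v^{−m/2})(x,t)|² ψ(x)^{m+2} η(t) dx dt ≤ (m² C(m+1)/(m+1)) ∫_{τ₁−τ}^{τ₂} ∫_{B_r(x₀)} ∫_{B_r(x₀)} (ψ(x) − ψ(y))² (ψ(x)^m v(x,t)^{−m} + ψ(y)^m v(y,t)^{−m}) η(t) K(x,y,t) dx dy dt + (m²/(m+1)) [ 2Λ ( sup_{x ∈ supp ψ} ∫_{ℝ^N ∖ B_r(x₀)} |x − y|^{−(N+2s)} dy ) ∫_{τ₁−τ}^{τ₂}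 ∫_{B_r(x₀)} v(x,t)^{−m} ψ(x)^{m+2} η(t) dx dt + (2Λ/l) ( esssup_{τ₁−τ < t < τ₂} sup_{x ∈ supp ψ} ∫_{ℝ^N ∖ B_R(x₀)} u₋(y,t) |x − y|^{−(N+2s)} dy ) ∫_{τ₁−τ}^{τ₂} ∫_{B_r(x₀)} v(x,t)^{−m} ψ(x)^{m+2} η(t) dx dt ] + (m²(m+2)²/(m+1)²) ∫_{τ₁−τ}^{τ₂} ∫_{B_r(x₀)} |∇ψ(x)|² v(x,t)^{−m} ψ(x)^m η(t) dx dt + (m/(m+1)) ∫_{τ₁−τ}^{τ₂} ∫_{B_r(x₀)} v(x,t)^{−m} ψ(x)^{m+2} |η'(t)| dx dt. -/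

import Mathlib

open MeasureTheory Metric Set
open scoped RealInnerProductSpace ENNReal

noncomputable section

/-- Euclidean space `ℝ^N`. -/
abbrev E (N : ℕ) : Type := EuclideanSpace ℝ (Fin N)

/-- The kernel `K` is measurable, symmetric in its first two arguments, and comparable to
the fractional kernel `|x-y|^{-(N+2s)}` with constant `Λ`, uniformly for `t ∈ (0,T)`. -/
def KernelOK (N : ℕ) (s Λ T : ℝ) (K : E N → E N → ℝ → ℝ) : Prop :=
  Measurable (fun p : E N × E N × ℝ => K p.1 p.2.1 p.2.2) ∧
  (∀ x y t, K x y t = K y x t) ∧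
  ∀ x y : E N, x ≠ y → ∀ t ∈ Set.Ioo 0 T,
    Λ⁻¹ * ‖x - y‖ ^ (-((N : ℝ) + 2 * s)) ≤ K x y t ∧
      K x y t ≤ Λ * ‖x - y‖ ^ (-((N : ℝ) + 2 * s))

/-- `u` is a (bounded, measurable, smooth in `Ω × (0,T)`) weak supersolution of
`∂ₜ u + 𝓛 u = Δ u` in `Ω × (0,T)`. -/
def IsWeakSupersolution (N : ℕ) (T : ℝ) (K : E N → E N → ℝ → ℝ)
    (Ω : Set (E N)) (u : E N → ℝ → ℝ) : Prop :=
  Measurable (fun p : E N × ℝ => u p.1 p.2) ∧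
  (∃ M : ℝ, ∀ x t, t ∈ Set.Ioo 0 T → |u x t| ≤ M) ∧
  ContDiffOn ℝ (⊤ : ℕ∞) (fun p : E N × ℝ => u p.1 p.2) (Ω ×ˢ Set.Ioo 0 T) ∧
  ∀ φ : E N → ℝ → ℝ,
    ContDiff ℝ (⊤ : ℕ∞) (fun p : E N × ℝ => φ p.1 p.2) →
    HasCompactSupport (fun p : E N × ℝ => φ p.1 p.2) →
    tsupport (fun p : E N × ℝ => φ p.1 p.2) ⊆ Ω ×ˢ Set.Ioo 0 T →
    (∀ x t, 0 ≤ φ x t) →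
    0 ≤ -(∫ t in Set.Ioo 0 T, ∫ x in Ω, u x t * deriv (fun τ => φ x τ) t) +
        (∫ t in Set.Ioo 0 T, ∫ x in Ω,
          ⟪gradient (fun y => u y t) x, gradient (fun y => φ y t) x⟫) +
        ∫ t in Set.Ioo 0 T, ∫ x : E N, ∫ y : E N,
          (u x t - u y t) * (φ x t - φ y t) * K x y t

/-- The negative part `u₋ = max(-u, 0)`. -/
def uminus (N : ℕ) (u : E N → ℝ → ℝ) : E N → ℝ → ℝ := fun x t => max (-(u x t)) 0

/-- The parabolic tail `Tail_∞(w; x₀, ρ, t₁, t₂)`. -/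
def tailInfty (N : ℕ) (s : ℝ) (w : E N → ℝ → ℝ) (x₀ : E N) (ρ t₁ t₂ : ℝ) : ℝ :=
  ρ ^ 2 * essSup
      (fun t => ∫ y in (Metric.ball x₀ ρ)ᶜ, |w y t| * ‖y - x₀‖ ^ (-((N : ℝ) + 2 * s)))
      (volume.restrict (Set.Ioo t₁ t₂))

open scoped Topology


lemma aux_tpow (m t : ℝ) (hm : 0 < m) (ht : 0 < t) :
    (t ^ m - 1) ^ 2 * t ≤ max 1 m * (1 + t ^ m) * ((1 - t) * (1 - t ^ m * t)) := by
  have hS : 0 < t ^ m := Real.rpow_pos_of_pos ht m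
  have hM1 : 1 ≤ max 1 m := le_max_left _ _
  set S := t ^ m with hSdef
  set M := max 1 m with hM
  rcases le_total t 1 with h | h
  · have hS1 : S ≤ 1 := Real.rpow_le_one ht.le h hm.le
    have h1 : 1 - S ≤ M * (1 - t) := by
      rcases le_total m 1 with h2 | h2
      · have : t ≤ S := by
          have := Real.rpow_le_rpow_of_exponent_ge ht h h2
          simpa using this
        nlinarith
      · have := one_add_mul_self_le_rpow_one_add (s := t - 1) (by linarith) h2
        have e : 1 + (t - 1) = t := by ring
        rw [e] at this
        have : m ≤ M := le_max_right _ _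
        nlinarith
    have h2 : 1 - S ≤ 1 - S * t := by nlinarith
    have h3 : (1 - S) * (1 - S) ≤ (M * (1 - t)) * (1 - S * t) :=
      mul_le_mul h1 h2 (by linarith) (by nlinarith)
    have h4 : 0 ≤ (M * (1 - t)) * (1 - S * t) := by
      apply mul_nonneg
      · nlinarith
      · nlinarith
    nlinarith
  · have hS1 : 1 ≤ S := Real.one_le_rpow h hm.le
    have h1 : S - 1 ≤ M * (t - 1) * (1 + S) / t ∨ S - 1 ≤ M * (t-1) := by
      rcases le_total m 1 with h2 | h2
      · right
        have : S ≤ t := by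
          have := Real.rpow_le_rpow_of_exponent_le h h2
          simpa using this
        nlinarith
      · left
        have := one_add_mul_self_le_rpow_one_add (s := t⁻¹ - 1) (by have := inv_pos.2 ht; linarith) h2
        have e : 1 + (t⁻¹ - 1) = t⁻¹ := by ring
        rw [e, Real.inv_rpow ht.le, ← hSdef] at this
        have hmM : m ≤ M := le_max_right _ _
        have h5 : 1 + m * (t⁻¹ - 1) = 1 - m * (t - 1) / t := by field_simp; ring
        rw [h5] at this
        have h6 : S * (1 - m * (t-1)/t) ≤ 1 := by
          calc _ ≤ S * S⁻¹ := by gcongr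
            _ = 1 := by field_simp
        have h7 : S - 1 ≤ m * (t-1) * S / t := by
          have : S * (1 - m * (t-1)/t) = S - m * (t-1) * S / t := by field_simp
          linarith
        refine h7.trans ?_
        gcongr
        linarith
    have h2 : (S - 1) * t ≤ S * t - 1 := by nlinarith
    have h2' : S - 1 ≤ S * t - 1 := by nlinarith
    rcases h1 with h1 | h1
    · have h3 : (S - 1) * t ≤ M * (t - 1) * (1 + S) := by rwa [le_div_iff₀ ht] at h1
      have h4 : ((S - 1) * t) * (S - 1) ≤ (M * (t - 1) * (1 + S)) * (S * t - 1) :=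
        mul_le_mul h3 h2' (by linarith) (by have : 0 ≤ t - 1 := by linarith
                                            positivity)
      nlinarith
    · have h4 : (S - 1) * ((S - 1) * t) ≤ (M * (t - 1)) * (S * t - 1) :=
        mul_le_mul h1 h2 (by nlinarith) (by have : 0 ≤ t - 1 := by linarith
                                            positivity)
      have : 0 ≤ (M * (t - 1)) * (S * t - 1) := by
        apply mul_nonneg <;> nlinarith
      nlinarith

/-- core quadratic inequality -/
lemma aux_quad (c A B S t : ℝ) (hA : 0 ≤ A) (hB : 0 ≤ B) (hS : 0 < S) (ht : 0 < t) (M : ℝ)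
    (hc : 8 ≤ c) (hcM : M ≤ c)
    (h : (S - 1) ^ 2 * t ≤ M * (1 + S) * ((1 - t) * (1 - S * t))) (hD : 0 ≤ (1 - t) * (1 - S * t)) :
    A ^ 2 + B ^ 2 * S - A * B * (S * t + 1 / t) ≤ c * (A - B) ^ 2 * (1 + S) := by
  set D := (1 - t) * (1 - S * t) / t with hDd
  have hD0 : 0 ≤ D := by positivity
  have e : A ^ 2 + B ^ 2 * S - A * B * (S * t + 1 / t) =
     - (A * B * D) + A * (B - A) * (S - 1) + (B - A) ^ 2 * S := by
    rw [hDd]; field_simp; ring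
  have h' : (S - 1) ^ 2 ≤ M * (1 + S) * D := by
    rw [hDd, ← mul_div_assoc, le_div_iff₀ ht]; exact h
  have h'' : (S - 1) ^ 2 ≤ c * (1 + S) * D := by
    refine h'.trans ?_
    gcongr
  rw [e]
  set k := B - A with hk
  have hk2 : (A - B) ^ 2 = k ^ 2 := by rw [hk]; ring
  rw [hk2]
  have hABD : 0 ≤ A * B * D := by positivity
  by_cases hcase : A ≤ 2 * |k|
  · have h1 : A * k * (S - 1) ≤ 2 * k ^ 2 * (1 + S) := by
      have : |A * k * (S - 1)| ≤ 2 * k^2 * (1 + S) := by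
        rw [abs_mul, abs_mul, abs_of_nonneg hA]
        have h2 : |S - 1| ≤ 1 + S := by rw [abs_le]; constructor <;> linarith
        calc A * |k| * |S - 1| ≤ (2 * |k|) * |k| * (1 + S) := by gcongr
          _ = 2 * k ^ 2 * (1 + S) := by rw [← sq_abs k]; ring
      exact (le_abs_self _).trans this
    have h3 : 0 ≤ k ^ 2 * (1 + S) := by positivity
    nlinarith [sq_nonneg k]
  · push Not at hcase
    have hBA : A / 2 ≤ B := by
      have : -|k| ≤ k := neg_abs_le k
      linarith
    have h1 : A ^ 2 / 2 * D ≤ A * B * D := by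
      have : A ^ 2 / 2 ≤ A * B := by nlinarith
      gcongr
    -- A k (S-1) ≤ A²(S-1)²/(2 c(1+S)) + c (1+S) k²/2
    have h2 : A * k * (S - 1) ≤ A ^ 2 / 2 * D + c * (1 + S) * k ^ 2 / 2 := by
      have hcs : 0 < c * (1 + S) := by positivity
      have h3 : 0 ≤ (A * (S - 1) - c * (1 + S) * k) ^ 2 := sq_nonneg _
      have h4 : A ^ 2 * (S - 1) ^ 2 ≤ A ^ 2 * (c * (1 + S) * D) := by gcongr
      have h5 : (c * (1 + S)) * (A * k * (S - 1)) ≤ (c * (1 + S)) * (A ^ 2 / 2 * D + c * (1 + S) * k ^ 2 / 2) := by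
        nlinarith
      exact le_of_mul_le_mul_left h5 hcs
    have h3 : 0 ≤ k ^ 2 * (1 + S) := by positivity
    nlinarith [sq_nonneg k]

lemma alg_ineq (m a b A B : ℝ) (hm : 0 < m) (ha : 0 < a) (hb : 0 < b) (hA : 0 ≤ A) (hB : 0 ≤ B) :
    (a - b) * (a ^ (-m - 1) * A ^ (m + 2) - b ^ (-m - 1) * B ^ (m + 2)) ≤
      2 * max 4 ((6 * m + 1) / 2) * ((A - B) ^ 2 * (A ^ m * a ^ (-m) + B ^ m * b ^ (-m))) := by
  have hc8 : 8 ≤ 2 * max 4 ((6 * m + 1) / 2) := by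
    have := le_max_left 4 ((6 * m + 1) / 2); linarith
  have hcm : max 1 m ≤ 2 * max 4 ((6 * m + 1) / 2) := by
    have := le_max_right 4 ((6 * m + 1) / 2)
    apply max_le <;> linarith
  generalize 2 * max 4 ((6 * m + 1) / 2) = c at *
  have ea : a ^ (-m - 1) = a ^ (-m) / a := by rw [Real.rpow_sub_one ha.ne']
  have eb : b ^ (-m - 1) = b ^ (-m) / b := by rw [Real.rpow_sub_one hb.ne']
  have pa : 0 < a ^ (-m) := Real.rpow_pos_of_pos ha _
  have pb : 0 < b ^ (-m) := Real.rpow_pos_of_pos hb _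
  have eA : A ^ (m + 2) = A ^ m * A ^ 2 := by
    rcases hA.eq_or_lt with h | h
    · rw [← h, Real.zero_rpow (by linarith)]; simp
    · rw [Real.rpow_add h]; norm_num
  have eB : B ^ (m + 2) = B ^ m * B ^ 2 := by
    rcases hB.eq_or_lt with h | h
    · rw [← h, Real.zero_rpow (by linarith)]; simp
    · rw [Real.rpow_add h]; norm_num
  have pA : 0 ≤ A ^ m := Real.rpow_nonneg hA _
  have pB : 0 ≤ B ^ m := Real.rpow_nonneg hB _
  rw [ea, eb, eA, eB]
  rcases hA.eq_or_lt with h | hA'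
  · subst h
    rw [Real.zero_rpow hm.ne']
    have : (a - b) * (a ^ (-m) / a * (0 * 0 ^ 2) - b ^ (-m) / b * (B ^ m * B ^ 2)) =
       (b ^ (-m) * (B ^ m * B ^ 2)) * (1 - a / b) := by field_simp; ring
    rw [this]
    have h1 : 1 - a / b ≤ 1 := by have : 0 < a / b := by positivity
                                  linarith
    have h0 : 0 ≤ b ^ (-m) * (B ^ m * B ^ 2) := by positivity
    nlinarith
  rcases hB.eq_or_lt with h | hB'
  · subst h
    rw [Real.zero_rpow hm.ne']
    have : (a - b) * (a ^ (-m) / a * (A ^ m * A ^ 2) - b ^ (-m) / b * (0 * 0 ^ 2)) =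
       (a ^ (-m) * (A ^ m * A ^ 2)) * (1 - b / a) := by field_simp; ring
    rw [this]
    have h1 : 1 - b / a ≤ 1 := by have : 0 < b / a := by positivity
                                  linarith
    have h0 : 0 ≤ a ^ (-m) * (A ^ m * A ^ 2) := by positivity
    nlinarith
  -- main case
  set al := A / a with hal
  set be := B / b with hbe
  have pal : 0 < al := by positivity
  have pbe : 0 < be := by positivity
  set t := be / al with htd
  have pt : 0 < t := by positivity
  have q1 : A ^ m * a ^ (-m) = al ^ m := by
    rw [hal, Real.div_rpow hA ha.le, Real.rpow_neg ha.le]; rfl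
  have q2 : B ^ m * b ^ (-m) = al ^ m * t ^ m := by
    rw [← Real.mul_rpow pal.le pt.le, htd, mul_div_cancel₀ _ pal.ne', hbe, Real.div_rpow hB hb.le, Real.rpow_neg hb.le]; rfl
  have hD : 0 ≤ (1 - t) * (1 - t ^ m * t) := by
    rcases le_total t 1 with h | h
    · have := Real.rpow_le_one pt.le h hm.le
      have := Real.rpow_pos_of_pos pt m
      apply mul_nonneg <;> nlinarith
    · have := Real.one_le_rpow h hm.le
      apply mul_nonneg_of_nonpos_of_nonpos <;> nlinarith
  have key := aux_quad c A B (t ^ m) t hA hB (Real.rpow_pos_of_pos pt m) pt (max 1 m) hc8 hcm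
    (aux_tpow m t hm pt) hD
  have pam : 0 < al ^ m := Real.rpow_pos_of_pos pal m
  have e1 : (a - b) * (a ^ (-m) / a * (A ^ m * A ^ 2) - b ^ (-m) / b * (B ^ m * B ^ 2)) =
     (a - b) * ((A ^ m * a ^ (-m)) * A ^ 2 / a - (B ^ m * b ^ (-m)) * B ^ 2 / b) := by ring
  rw [e1, q1, q2]
  have e2 : (a - b) * (al ^ m * A ^ 2 / a - al ^ m * t ^ m * B ^ 2 / b) =
     al ^ m * (A ^ 2 + B ^ 2 * t ^ m - A * B * (t ^ m * t + 1 / t)) := by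
    generalize t ^ m = S
    generalize al ^ m = W
    rw [htd, hal, hbe]
    field_simp
    ring
  rw [e2]
  calc _ ≤ al ^ m * (c * (A - B) ^ 2 * (1 + t ^ m)) := by gcongr
    _ = _ := by ring


def kap (N : ℕ) (s : ℝ) (z : E N) : ℝ := min 1 (‖z‖ ^ 2) * ‖z‖ ^ (-((N : ℝ) + 2 * s))

lemma kap_nonneg (N : ℕ) (s : ℝ) (z : E N) : 0 ≤ kap N s z := by
  unfold kap; positivity

lemma kap_neg (N : ℕ) (s : ℝ) (z : E N) : kap N s (-z) = kap N s z := by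
  simp [kap]

lemma kap_meas (N : ℕ) (s : ℝ) : Measurable (kap N s) := by
  unfold kap; fun_prop

lemma kap_integrable (N : ℕ) (hN : 2 ≤ N) (s : ℝ) (hs : s ∈ Set.Ioo (0 : ℝ) 1) :
    Integrable (kap N s) := by
  have : Nonempty (Fin N) := ⟨⟨0, by omega⟩⟩
  have := (integrable_fun_norm_addHaar (volume : Measure (E N))
    (f := fun y : ℝ => min 1 (y ^ 2) * y ^ (-((N : ℝ) + 2 * s)))).2 ?_
  · exact this
  have hd : Module.finrank ℝ (E N) = N := by simp
  rw [hd]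
  rw [← Set.Ioc_union_Ioi_eq_Ioi (zero_le_one : (0:ℝ) ≤ 1)]
  have hcast : ((N - 1 : ℕ) : ℝ) = (N : ℝ) - 1 := by
    rw [Nat.cast_sub (by omega)]; simp
  apply IntegrableOn.union
  · have h1 : IntegrableOn (fun y : ℝ => y ^ (1 - 2 * s)) (Ioc 0 1) := by
      have := intervalIntegral.intervalIntegrable_rpow' (a := 0) (b := 1) (r := 1 - 2 * s) (by linarith [hs.2])
      rwa [intervalIntegrable_iff_integrableOn_Ioc_of_le zero_le_one] at this
    refine h1.congr_fun (fun y hy => ?_) measurableSet_Ioc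
    have hy0 : 0 < y := hy.1
    have : y ^ 2 ≤ 1 := by nlinarith [hy.2]
    simp only [min_eq_right this, smul_eq_mul]
    rw [← Real.rpow_natCast y (N - 1), ← Real.rpow_natCast y 2, ← Real.rpow_add hy0, ← Real.rpow_add hy0, hcast]
    congr 1; push_cast; ring
  · have h1 : IntegrableOn (fun y : ℝ => y ^ (-1 - 2 * s)) (Ioi 1) :=
      (integrableOn_Ioi_rpow_iff zero_lt_one).2 (by linarith [hs.1])
    refine h1.congr_fun (fun y hy => ?_) measurableSet_Ioi
    have hy1 : 1 < y := hy
    have hy0 : 0 < y := by linarith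
    have : 1 ≤ y ^ 2 := by nlinarith
    simp only [min_eq_left this, smul_eq_mul]
    rw [← Real.rpow_natCast y (N - 1), one_mul, ← Real.rpow_add hy0, hcast]
    congr 1; ring

/-- lower bound away from the diagonal -/
lemma kap_off (N : ℕ) (s d : ℝ) (hd : 0 < d) (hd1 : d ≤ 1) (z : E N) (hz : d ≤ ‖z‖) :
    ‖z‖ ^ (-((N : ℝ) + 2 * s)) ≤ (d ^ 2)⁻¹ * kap N s z := by
  unfold kap
  have h1 : d ^ 2 ≤ min 1 (‖z‖ ^ 2) := by
    apply le_min <;> nlinarith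
  have h2 : 1 ≤ (d ^ 2)⁻¹ * min 1 (‖z‖ ^ 2) := by
    rw [inv_mul_eq_div, le_div_iff₀ (by positivity)]; linarith
  have h3 : 0 ≤ ‖z‖ ^ (-((N : ℝ) + 2 * s)) := by positivity
  rw [← mul_assoc]
  nlinarith

lemma kap_near (N : ℕ) (s D : ℝ) (hD : 1 ≤ D) (z : E N) (hz : ‖z‖ ≤ D) :
    ‖z‖ ^ 2 * ‖z‖ ^ (-((N : ℝ) + 2 * s)) ≤ D ^ 2 * kap N s z := by
  unfold kap
  have h1 : ‖z‖ ^ 2 ≤ D ^ 2 * min 1 (‖z‖ ^ 2) := by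
    rcases le_total 1 (‖z‖ ^ 2) with h | h
    · rw [min_eq_left h]; have := norm_nonneg z; nlinarith
    · rw [min_eq_right h]; exact le_mul_of_one_le_left (sq_nonneg _) (by nlinarith)
  have h3 : 0 ≤ ‖z‖ ^ (-((N : ℝ) + 2 * s)) := by positivity
  rw [← mul_assoc]
  gcongr

/-- dominating function -/
def domF (N : ℕ) (s : ℝ) (B : Set (E N)) (p : E N × E N) : ℝ :=
  (B.indicator 1 p.1 + B.indicator 1 p.2) * kap N s (p.1 - p.2)

lemma domF_nonneg (N : ℕ) (s : ℝ) (B : Set (E N)) (p : E N × E N) : 0 ≤ domF N s B p := by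
  unfold domF
  have h : ∀ x, 0 ≤ B.indicator (1 : E N → ℝ) x := fun x => by
    apply indicator_nonneg; simp
  exact mul_nonneg (add_nonneg (h _) (h _)) (kap_nonneg _ _ _)

lemma domF_left (N : ℕ) (s : ℝ) (B : Set (E N)) (x y : E N) (hx : x ∈ B) :
    kap N s (x - y) ≤ domF N s B (x, y) := by
  unfold domF
  have h : ∀ x, 0 ≤ B.indicator (1 : E N → ℝ) x := fun x => by
    apply indicator_nonneg; simp
  have := h y
  have h2 := kap_nonneg N s (x - y)
  simp only [indicator_of_mem hx, Pi.one_apply]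
  nlinarith

lemma domF_symm (N : ℕ) (s : ℝ) (B : Set (E N)) (x y : E N) :
    domF N s B (x, y) = domF N s B (y, x) := by
  unfold domF
  simp only
  rw [← kap_neg, neg_sub, add_comm]

lemma domF_right (N : ℕ) (s : ℝ) (B : Set (E N)) (x y : E N) (hx : y ∈ B) :
    kap N s (x - y) ≤ domF N s B (x, y) := by
  rw [domF_symm, ← kap_neg, neg_sub]
  exact domF_left N s B y x hx

lemma domF_integrable (N : ℕ) (hN : 2 ≤ N) (s : ℝ) (hs : s ∈ Set.Ioo (0 : ℝ) 1) (x₀ : E N) (r : ℝ) :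
    Integrable (domF N s (ball x₀ r)) (volume.prod volume) := by
  have hk := kap_integrable N hN s hs
  have hB : Integrable ((ball x₀ r).indicator (1 : E N → ℝ)) := by
    rw [integrable_indicator_iff measurableSet_ball]
    exact integrableOn_const measure_ball_lt_top.ne
  have h0 : Integrable (fun p : E N × E N => (ball x₀ r).indicator (1 : E N → ℝ) p.1 * kap N s p.2)
    (volume.prod volume) := hB.mul_prod hk
  have h1 : Integrable (fun p : E N × E N => (ball x₀ r).indicator (1 : E N → ℝ) p.1 * kap N s (p.1 - p.2))
    (volume.prod volume) := by
    have hmp : MeasurePreserving (fun p : E N × E N => (p.1, p.1 - p.2)) (volume.prod volume) (volume.prod volume) := by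
      have h2 : MeasurePreserving (fun p : E N × E N => (p.1, -p.1 + p.2)) (volume.prod volume) (volume.prod volume) :=
        measurePreserving_prod_neg_add volume volume
      have h3 : MeasurePreserving (fun p : E N × E N => (p.1, -p.2)) (volume.prod volume) (volume.prod volume) :=
        (MeasurePreserving.id volume).prod (Measure.measurePreserving_neg volume)
      have := h3.comp h2
      convert this using 2
      simp [Function.comp]
      abel
    exact (hmp.integrable_comp h0.aestronglyMeasurable).2 h0
  have h2 := h1.swap
  refine (h1.add h2).congr (ae_of_all _ fun p => ?_)
  simp only [domF, Pi.add_apply, Function.comp, Prod.fst_swap, Prod.snd_swap]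
  rw [show p.2 - p.1 = -(p.1 - p.2) by abel, kap_neg]
  ring

lemma exists_dist (N : ℕ) (x₀ : E N) (r : ℝ) (ψ : E N → ℝ) (hψc : HasCompactSupport ψ)
    (hψsupp : tsupport ψ ⊆ ball x₀ r) :
    ∃ d : ℝ, 0 < d ∧ d ≤ 1 ∧ ∀ x ∈ tsupport ψ, ∀ y ∉ ball x₀ r, d ≤ ‖x - y‖ := by
  obtain ⟨δ, hδ, h⟩ := IsCompact.exists_thickening_subset_open (show IsCompact (tsupport ψ) from hψc) isOpen_ball hψsupp
  refine ⟨min δ 1, by positivity, min_le_right _ _, fun x hx y hy => ?_⟩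
  refine (min_le_left _ _).trans ?_
  by_contra! hlt
  exact hy (h (mem_thickening_iff.2 ⟨x, hx, by rw [dist_comm, dist_eq_norm]; exact hlt⟩))

lemma le_biSup' {α : Type*} (S : Set α) (f : α → ℝ) (C : ℝ) (h0 : ∀ x ∈ S, 0 ≤ f x)
    (hC : ∀ x ∈ S, f x ≤ C) : (∀ x ∈ S, f x ≤ ⨆ x ∈ S, f x) ∧ 0 ≤ (⨆ x ∈ S, f x) ∧
      (0 ≤ C → (⨆ x ∈ S, f x) ≤ C) := by
  have hn : ∀ x, 0 ≤ ⨆ (_ : x ∈ S), f x := fun x => Real.iSup_nonneg (fun h => h0 x h)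
  have hle : ∀ x, (⨆ (_ : x ∈ S), f x) ≤ max C 0 := fun x =>
    Real.iSup_le (fun h => (hC x h).trans (le_max_left _ _)) (le_max_right _ _)
  have hb : BddAbove (range fun x => ⨆ (_ : x ∈ S), f x) := ⟨max C 0, by rintro _ ⟨x, rfl⟩; exact hle x⟩
  refine ⟨fun x hx => ?_, Real.iSup_nonneg hn, fun hC0 => Real.iSup_le (fun x => (hle x).trans (by rw [max_eq_left hC0])) hC0⟩
  refine le_trans ?_ (le_ciSup hb x)
  have : Nonempty (x ∈ S) := ⟨hx⟩
  rw [ciSup_const]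



def Psi (m ε z : ℝ) : ℝ := (z + ε) ^ (m + 2) - ε ^ (m + 2)

def fe (N : ℕ) (l m ε : ℝ) (ψ w : E N → ℝ) (x : E N) : ℝ := (w x + l) ^ (-m - 1) * Psi m ε (ψ x)

lemma Psi_zero' (m z : ℝ) (hm : 0 < m) : Psi m 0 z = z ^ (m + 2) := by
  simp [Psi, Real.zero_rpow (show m + 2 ≠ 0 by linarith)]

lemma Psi_at_zero (m ε : ℝ) : Psi m ε 0 = 0 := by simp [Psi]

lemma Psi_nonneg (m ε z : ℝ) (hm : 0 < m) (hε : 0 ≤ ε) (hz : 0 ≤ z) : 0 ≤ Psi m ε z := by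
  unfold Psi
  have : ε ^ (m + 2) ≤ (z + ε) ^ (m + 2) := Real.rpow_le_rpow hε (by linarith) (by linarith)
  linarith

lemma Psi_le (m ε z P : ℝ) (hm : 0 < m) (hε : 0 ≤ ε) (hε1 : ε ≤ 1) (hz : 0 ≤ z) (hzP : z ≤ P) :
    Psi m ε z ≤ (P + 1) ^ (m + 2) := by
  unfold Psi
  have : (z + ε) ^ (m + 2) ≤ (P + 1) ^ (m + 2) :=
    Real.rpow_le_rpow (by linarith) (by linarith) (by linarith)
  have : 0 ≤ ε ^ (m + 2) := by positivity
  linarith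

lemma rpow_lip (q P a b : ℝ) (hq : 1 ≤ q) (ha : 0 ≤ a) (hb : 0 ≤ b) (haP : a ≤ P) (hbP : b ≤ P) :
    |a ^ q - b ^ q| ≤ q * P ^ (q - 1) * |a - b| := by
  have := (convex_Icc (0:ℝ) P).norm_image_sub_le_of_norm_hasDerivWithin_le
    (f := fun x => x ^ q) (f' := fun x => q * x ^ (q - 1)) (C := q * P ^ (q - 1)) (x := b) (y := a)
    (fun x hx => (Real.hasDerivAt_rpow_const (Or.inr hq)).hasDerivWithinAt)
    (fun x hx => by
      rw [Real.norm_eq_abs, abs_of_nonneg (mul_nonneg (by linarith) (Real.rpow_nonneg hx.1 _))]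
      have : x ^ (q - 1) ≤ P ^ (q - 1) := Real.rpow_le_rpow hx.1 hx.2 (by linarith)
      gcongr) ⟨hb, hbP⟩ ⟨ha, haP⟩
  simpa using this

lemma rpow_neg_lip (q l a b : ℝ) (hq : 0 < q) (hl : 0 < l) (ha : l ≤ a) (hb : l ≤ b) :
    |a ^ (-q) - b ^ (-q)| ≤ q * l ^ (-q - 1) * |a - b| := by
  have := (convex_Ici l).norm_image_sub_le_of_norm_hasDerivWithin_le
    (f := fun x => x ^ (-q)) (f' := fun x => -q * x ^ (-q - 1)) (C := q * l ^ (-q - 1)) (x := b) (y := a)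
    (fun x hx => (Real.hasDerivAt_rpow_const (Or.inl (hl.trans_le hx).ne')).hasDerivWithinAt)
    (fun x hx => by
      have hx0 : 0 < x := hl.trans_le hx
      rw [Real.norm_eq_abs, abs_mul, abs_neg, abs_of_pos hq, abs_of_pos (Real.rpow_pos_of_pos hx0 _)]
      have : x ^ (-q - 1) ≤ l ^ (-q - 1) := Real.rpow_le_rpow_of_nonpos hl hx (by linarith)
      gcongr) hb ha
  simpa using this

lemma rpow_neg_le (q l a : ℝ) (hq : 0 ≤ q) (hl : 0 < l) (ha : l ≤ a) : a ^ (-q) ≤ l ^ (-q) :=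
  Real.rpow_le_rpow_of_nonpos hl ha (by linarith)

structure SpOK (N : ℕ) (s Λ : ℝ) (x₀ : E N) (r M : ℝ) (w : E N → ℝ) (k : E N → E N → ℝ) : Prop where
  wm : Measurable w
  wb : ∀ x, |w x| ≤ M
  w0 : ∀ x ∈ ball x₀ r, 0 ≤ w x
  km : Measurable (fun p : E N × E N => k p.1 p.2)
  ks : ∀ x y, k x y = k y x
  k0 : ∀ x y, x ≠ y → 0 ≤ k x y
  k1 : ∀ x y, x ≠ y → k x y ≤ Λ * ‖x - y‖ ^ (-((N : ℝ) + 2 * s))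

structure PsiOK (N : ℕ) (x₀ : E N) (r P Q d : ℝ) (ψ : E N → ℝ) : Prop where
  cont : Continuous ψ
  nn : ∀ x, 0 ≤ ψ x
  le : ∀ x, ψ x ≤ P
  lip : ∀ x y, |ψ x - ψ y| ≤ Q * ‖x - y‖
  Q0 : 0 ≤ Q
  supp : ∀ x, x ∉ ball x₀ r → ψ x = 0
  d0 : 0 < d
  d1 : d ≤ 1
  dist : ∀ x ∈ tsupport ψ, ∀ y ∉ ball x₀ r, d ≤ ‖x - y‖

lemma PsiOK.P0 {N : ℕ} {x₀ : E N} {r P Q d : ℝ} {ψ : E N → ℝ} (h : PsiOK N x₀ r P Q d ψ) : 0 ≤ P :=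
  (h.nn x₀).trans (h.le x₀)

lemma PsiOK.dist' {N : ℕ} {x₀ : E N} {r P Q d : ℝ} {ψ : E N → ℝ} (h : PsiOK N x₀ r P Q d ψ)
    (x : E N) (hx : ψ x ≠ 0) : ∀ y ∉ ball x₀ r, d ≤ ‖x - y‖ :=
  h.dist x (subset_tsupport _ hx)

lemma fe_bound {N : ℕ} {s Λ : ℝ} {x₀ : E N} {r M P Q d l m ε : ℝ} {ψ w : E N → ℝ}
    {k : E N → E N → ℝ} (hw : SpOK N s Λ x₀ r M w k) (hψ : PsiOK N x₀ r P Q d ψ)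
    (hl : 0 < l) (hm : 0 < m) (hε : 0 ≤ ε) (hε1 : ε ≤ 1) (x : E N) :
    |fe N l m ε ψ w x| ≤ l ^ (-m - 1) * (P + 1) ^ (m + 2) := by
  have hP := hψ.P0
  unfold fe
  by_cases hx : x ∈ ball x₀ r
  · have h1 : l ≤ w x + l := by linarith [hw.w0 x hx]
    have h2 : (w x + l) ^ (-m - 1) ≤ l ^ (-m - 1) := Real.rpow_le_rpow_of_nonpos hl h1 (by linarith)
    have h3 := Psi_le m ε (ψ x) P hm hε hε1 (hψ.nn x) (hψ.le x)
    have h4 := Psi_nonneg m ε (ψ x) hm hε (hψ.nn x)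
    have h5 : 0 ≤ (w x + l) ^ (-m - 1) := Real.rpow_nonneg (by linarith) _
    rw [abs_of_nonneg (by positivity)]
    gcongr
  · rw [hψ.supp x hx, Psi_at_zero]
    simp; positivity

lemma fe_lip {N : ℕ} {s Λ : ℝ} {x₀ : E N} {r M P Q d l m ε Lw : ℝ} {ψ w : E N → ℝ}
    {k : E N → E N → ℝ} (hw : SpOK N s Λ x₀ r M w k) (hψ : PsiOK N x₀ r P Q d ψ)
    (hl : 0 < l) (hm : 0 < m) (hε : 0 ≤ ε) (hε1 : ε ≤ 1)
    (hLw : ∀ x ∈ ball x₀ r, ∀ y ∈ ball x₀ r, |w x - w y| ≤ Lw * ‖x - y‖)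
    (x : E N) (hx : x ∈ ball x₀ r) (y : E N) (hy : y ∈ ball x₀ r) :
    |fe N l m ε ψ w x - fe N l m ε ψ w y| ≤ ((m + 1) * l ^ (-m - 2) * Lw * (P + 1) ^ (m + 2) +
      l ^ (-m - 1) * ((m + 2) * (P + 1) ^ (m + 1) * Q)) * ‖x - y‖ := by
  have hP := hψ.P0
  unfold fe
  set a := w x + l
  set b := w y + l
  have ha : l ≤ a := by have := hw.w0 x hx; simp only [a]; linarith
  have hb : l ≤ b := by have := hw.w0 y hy; simp only [b]; linarith
  have h1 := rpow_neg_lip (m + 1) l a b (by linarith) hl ha hb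
  rw [show -(m + 1) = -m - 1 by ring, show -m - 1 - 1 = -m - 2 by ring] at h1
  have e : a - b = w x - w y := by simp only [a, b]; ring
  rw [e] at h1
  have hl2 : 0 ≤ l ^ (-m - 2) := by positivity
  have h1' : |a ^ (-m - 1) - b ^ (-m - 1)| ≤ (m + 1) * l ^ (-m - 2) * (Lw * ‖x - y‖) := by
    refine h1.trans ?_
    gcongr
    exact hLw x hx y hy
  have h2 : |Psi m ε (ψ x) - Psi m ε (ψ y)| ≤ (m + 2) * (P + 1) ^ (m + 1) * (Q * ‖x - y‖) := by
    unfold Psi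
    have h3 := rpow_lip (m + 2) (P + 1) (ψ x + ε) (ψ y + ε) (by linarith) (by linarith [hψ.nn x])
      (by linarith [hψ.nn y]) (by linarith [hψ.le x]) (by linarith [hψ.le y])
    rw [show m + 2 - 1 = m + 1 by ring] at h3
    rw [show (ψ x + ε) ^ (m + 2) - ε ^ (m + 2) - ((ψ y + ε) ^ (m + 2) - ε ^ (m + 2)) =
      (ψ x + ε) ^ (m + 2) - (ψ y + ε) ^ (m + 2) by ring]
    refine h3.trans ?_
    have := hψ.lip x y
    rw [show ψ x + ε - (ψ y + ε) = ψ x - ψ y by ring]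
    gcongr
  have h3 : |Psi m ε (ψ x)| ≤ (P + 1) ^ (m + 2) := by
    rw [abs_of_nonneg (Psi_nonneg m ε (ψ x) hm hε (hψ.nn x))]
    exact Psi_le m ε (ψ x) P hm hε hε1 (hψ.nn x) (hψ.le x)
  have h4 : |b ^ (-m - 1)| ≤ l ^ (-m - 1) := by
    rw [abs_of_nonneg (Real.rpow_nonneg (by linarith) _)]
    exact Real.rpow_le_rpow_of_nonpos hl hb (by linarith)
  have h1n := (abs_nonneg _).trans h1'
  have h2n := (abs_nonneg _).trans h2
  calc |a ^ (-m - 1) * Psi m ε (ψ x) - b ^ (-m - 1) * Psi m ε (ψ y)|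
      = |(a ^ (-m - 1) - b ^ (-m - 1)) * Psi m ε (ψ x) + b ^ (-m - 1) * (Psi m ε (ψ x) - Psi m ε (ψ y))| := by
        congr 1; ring
    _ ≤ |a ^ (-m - 1) - b ^ (-m - 1)| * |Psi m ε (ψ x)| + |b ^ (-m - 1)| * |Psi m ε (ψ x) - Psi m ε (ψ y)| := by
        rw [← abs_mul, ← abs_mul]; exact abs_add_le _ _
    _ ≤ (m + 1) * l ^ (-m - 2) * (Lw * ‖x - y‖) * (P + 1) ^ (m + 2) +
        l ^ (-m - 1) * ((m + 2) * (P + 1) ^ (m + 1) * (Q * ‖x - y‖)) := by gcongr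
    _ = _ := by ring

lemma k_abs {N : ℕ} {s Λ : ℝ} {x₀ : E N} {r M : ℝ} {w : E N → ℝ}
    {k : E N → E N → ℝ} (hw : SpOK N s Λ x₀ r M w k) (x y : E N) (h : x ≠ y) :
    |k x y| ≤ Λ * ‖x - y‖ ^ (-((N : ℝ) + 2 * s)) := by
  rw [abs_of_nonneg (hw.k0 x y h)]; exact hw.k1 x y h

lemma kap_ball (N : ℕ) (s r : ℝ) (x₀ x y : E N) (hr : 0 < r) (hr1 : r ≤ 1) (hx : x ∈ ball x₀ r) (hy : y ∈ ball x₀ r) :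
    ‖x - y‖ ^ 2 * ‖x - y‖ ^ (-((N : ℝ) + 2 * s)) ≤ 4 * domF N s (ball x₀ r) (x, y) := by
  have h1 : ‖x - y‖ ≤ 2 := by
    rw [← dist_eq_norm]
    have := dist_triangle_right x y x₀
    have h1 := mem_ball.1 hx
    have h2 := mem_ball.1 hy
    linarith
  have := kap_near N s 2 (by norm_num) (x - y) h1
  have := domF_left N s (ball x₀ r) x y hx
  linarith

lemma dom_bound (N : ℕ) (s Λ : ℝ) (hΛ : 0 ≤ Λ) (x₀ : E N) (r M P Q d l m Lw : ℝ)
    (ψ : E N → ℝ) (hr : 0 < r) (hr1 : r ≤ 1) (hψ : PsiOK N x₀ r P Q d ψ)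
    (hl : 0 < l) (hm : 0 < m) (hLw0 : 0 ≤ Lw) :
    ∃ C : ℝ, 0 ≤ C ∧ ∀ (w : E N → ℝ) (k : E N → E N → ℝ) (ε : ℝ), SpOK N s Λ x₀ r M w k → 0 ≤ ε → ε ≤ 1 →
    (∀ x ∈ ball x₀ r, ∀ y ∈ ball x₀ r, |w x - w y| ≤ Lw * ‖x - y‖) →
    ∀ x y, |(w x - w y) * (fe N l m ε ψ w x - fe N l m ε ψ w y) * k x y| ≤ C * domF N s (ball x₀ r) (x, y) := by
  have hP := hψ.P0
  have hQ := hψ.Q0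
  have hd := hψ.d0
  set Lf := ((m + 1) * l ^ (-m - 2) * Lw * (P + 1) ^ (m + 2) +
      l ^ (-m - 1) * ((m + 2) * (P + 1) ^ (m + 1) * Q)) with hLf
  have hLf0 : 0 ≤ Lf := by positivity
  set F := l ^ (-m - 1) * (P + 1) ^ (m + 2) with hF
  have hF0 : 0 ≤ F := by positivity
  set C1 := Lw * Lf * Λ * 4 with hC1
  have hC1 : 0 ≤ C1 := by positivity
  set C2 := 2 * |M| * F * Λ * (d ^ 2)⁻¹ with hC2
  have hC2 : 0 ≤ C2 := by positivity
  refine ⟨C1 + C2, by positivity, fun w k ε hw hε hε1 hLw => ?_⟩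
  -- one-sided case
  have one : ∀ x y, x ∈ ball x₀ r → y ∉ ball x₀ r →
      |(w x - w y) * (fe N l m ε ψ w x - fe N l m ε ψ w y) * k x y| ≤ (C1 + C2) * domF N s (ball x₀ r) (x, y) := by
    intro x y hx hy
    have hD := domF_nonneg N s (ball x₀ r) (x, y)
    have hfy : fe N l m ε ψ w y = 0 := by simp [fe, hψ.supp y hy, Psi_at_zero]
    by_cases hxz : ψ x = 0
    · have hfx : fe N l m ε ψ w x = 0 := by simp [fe, hxz, Psi_at_zero]
      rw [hfx, hfy]; simp; positivity
    have hdist := hψ.dist' x hxz y hy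
    have hne : x ≠ y := fun h => hy (h ▸ hx)
    have h1 : |w x - w y| ≤ 2 * |M| := by
      have := abs_sub (w x) (w y)
      have := hw.wb x
      have := hw.wb y
      have := le_abs_self M
      linarith
    have h2 := fe_bound hw hψ hl hm hε hε1 x
    rw [hfy, sub_zero, abs_mul, abs_mul]
    have h3 := k_abs hw x y hne
    have h4 := kap_off N s d hψ.d0 hψ.d1 (x - y) hdist
    have h5 := domF_left N s (ball x₀ r) x y hx
    calc _ ≤ (2 * |M|) * F * (Λ * ((d ^ 2)⁻¹ * domF N s (ball x₀ r) (x, y))) := by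
          gcongr
          refine h3.trans ?_
          gcongr
          refine h4.trans ?_
          gcongr
      _ = C2 * domF N s (ball x₀ r) (x, y) := by ring
      _ ≤ _ := by gcongr; linarith
  intro x y
  have hD := domF_nonneg N s (ball x₀ r) (x, y)
  by_cases hx : x ∈ ball x₀ r <;> by_cases hy : y ∈ ball x₀ r
  · rcases eq_or_ne x y with h | hne
    · subst h; simp; positivity
    have h1 := hLw x hx y hy
    have h2 := fe_lip hw hψ hl hm hε hε1 hLw x hx y hy
    have h3 := k_abs hw x y hne
    have h4 := kap_ball N s r x₀ x y hr hr1 hx hy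
    rw [abs_mul, abs_mul]
    calc _ ≤ (Lw * ‖x - y‖) * (Lf * ‖x - y‖) * (Λ * ‖x - y‖ ^ (-((N : ℝ) + 2 * s))) := by gcongr
      _ = Lw * Lf * Λ * (‖x - y‖ ^ 2 * ‖x - y‖ ^ (-((N : ℝ) + 2 * s))) := by ring
      _ ≤ Lw * Lf * Λ * (4 * domF N s (ball x₀ r) (x, y)) := by gcongr
      _ = C1 * domF N s (ball x₀ r) (x, y) := by ring
      _ ≤ _ := by gcongr; linarith
  · exact one x y hx hy
  · have := one y x hy hx
    rw [domF_symm, hw.ks x y]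
    rw [show (w x - w y) * (fe N l m ε ψ w x - fe N l m ε ψ w y) = (w y - w x) * (fe N l m ε ψ w y - fe N l m ε ψ w x) by ring]
    exact this
  · simp [fe, hψ.supp y hy, hψ.supp x hx, Psi_at_zero]; positivity


lemma int_of_dom (N : ℕ) (hN : 2 ≤ N) (s : ℝ) (hs : s ∈ Set.Ioo (0 : ℝ) 1) (x₀ : E N) (r C : ℝ)
    (F : E N × E N → ℝ) (hF : Measurable F) (hb : ∀ p, |F p| ≤ C * domF N s (ball x₀ r) p) :
    Integrable F (volume.prod volume) :=
  ((domF_integrable N hN s hs x₀ r).const_mul C).mono' hF.aestronglyMeasurable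
    (ae_of_all _ fun p => hb p)

lemma fe_meas {N : ℕ} (l m ε : ℝ) (ψ w : E N → ℝ) (hψ : Measurable ψ) (hw : Measurable w) :
    Measurable (fe N l m ε ψ w) := by
  unfold fe Psi
  fun_prop

/-- the tail integrals -/
lemma tail_integrable (N : ℕ) (hN : 2 ≤ N) (s : ℝ) (hs : s ∈ Set.Ioo (0 : ℝ) 1) (d : ℝ) (hd : 0 < d)
    (hd1 : d ≤ 1) (x : E N) (S : Set (E N)) (hS : MeasurableSet S) (h : ∀ y ∈ S, d ≤ ‖x - y‖) :
    IntegrableOn (fun y => ‖x - y‖ ^ (-((N : ℝ) + 2 * s))) S ∧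
     ∫ y in S, ‖x - y‖ ^ (-((N : ℝ) + 2 * s)) ≤ (d ^ 2)⁻¹ * ∫ z, kap N s z := by
  have hk : Integrable (fun y => (d ^ 2)⁻¹ * kap N s (x - y)) :=
    ((kap_integrable N hN s hs).comp_sub_left x).const_mul _
  have hi : IntegrableOn (fun y => ‖x - y‖ ^ (-((N : ℝ) + 2 * s))) S := by
    refine Integrable.mono' hk.integrableOn (Measurable.aestronglyMeasurable (by fun_prop)) ?_
    refine (ae_restrict_iff' hS).2 (ae_of_all _ fun y hy => ?_)
    rw [Real.norm_eq_abs, abs_of_nonneg (by positivity)]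
    exact kap_off N s d hd hd1 _ (h y hy)
  refine ⟨hi, ?_⟩
  calc _ ≤ ∫ y in S, (d ^ 2)⁻¹ * kap N s (x - y) :=
        setIntegral_mono_on hi hk.integrableOn hS fun y hy => kap_off N s d hd hd1 _ (h y hy)
    _ ≤ ∫ y, (d ^ 2)⁻¹ * kap N s (x - y) := by
        refine setIntegral_le_integral hk (ae_of_all _ fun y => ?_)
        have := kap_nonneg N s (x - y)
        simp only [Pi.zero_apply]; positivity
    _ = _ := by rw [integral_const_mul, integral_sub_left_eq_self (kap N s) volume x]

lemma tail_integrable_mul (N : ℕ) (hN : 2 ≤ N) (s : ℝ) (hs : s ∈ Set.Ioo (0 : ℝ) 1) (d M : ℝ) (hd : 0 < d)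
    (hd1 : d ≤ 1) (x : E N) (S : Set (E N)) (hS : MeasurableSet S) (h : ∀ y ∈ S, d ≤ ‖x - y‖)
    (g : E N → ℝ) (hg : Measurable g) (hgM : ∀ y, |g y| ≤ M) :
    IntegrableOn (fun y => g y * ‖x - y‖ ^ (-((N : ℝ) + 2 * s))) S ∧
     ∫ y in S, g y * ‖x - y‖ ^ (-((N : ℝ) + 2 * s)) ≤ M * ((d ^ 2)⁻¹ * ∫ z, kap N s z) := by
  obtain ⟨h1, h2⟩ := tail_integrable N hN s hs d hd hd1 x S hS h
  have hM : 0 ≤ M := (abs_nonneg _).trans (hgM x)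
  have hi : IntegrableOn (fun y => g y * ‖x - y‖ ^ (-((N : ℝ) + 2 * s))) S := by
    refine Integrable.mono' (h1.const_mul M) (Measurable.aestronglyMeasurable (by fun_prop)) (ae_of_all _ fun y => ?_)
    have : 0 ≤ ‖x - y‖ ^ (-((N : ℝ) + 2 * s)) := by positivity
    rw [Real.norm_eq_abs, abs_mul, abs_of_nonneg this]
    exact mul_le_mul_of_nonneg_right (hgM y) this
  refine ⟨hi, ?_⟩
  calc _ ≤ ∫ y in S, M * ‖x - y‖ ^ (-((N : ℝ) + 2 * s)) := by
        refine setIntegral_mono hi (h1.const_mul M) fun y => ?_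
        have : 0 ≤ ‖x - y‖ ^ (-((N : ℝ) + 2 * s)) := by positivity
        exact mul_le_mul_of_nonneg_right ((le_abs_self _).trans (hgM y)) this
    _ ≤ _ := by rw [integral_const_mul]; gcongr

def Jint (N : ℕ) (l m : ℝ) (ψ w : E N → ℝ) (k : E N → E N → ℝ) (x y : E N) : ℝ :=
  (ψ x - ψ y) ^ 2 * (ψ x ^ m * (w x + l) ^ (-m) + ψ y ^ m * (w y + l) ^ (-m)) * k x y

lemma Jint_bound {N : ℕ} {s Λ : ℝ} (hΛ : 0 ≤ Λ) {x₀ : E N} {r M P Q d l m : ℝ} {ψ w : E N → ℝ}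
    {k : E N → E N → ℝ} (hr : 0 < r) (hr1 : r ≤ 1) (hw : SpOK N s Λ x₀ r M w k) (hψ : PsiOK N x₀ r P Q d ψ)
    (hl : 0 < l) (hm : 0 < m) (x y : E N) (hx : x ∈ ball x₀ r) (hy : y ∈ ball x₀ r) :
    0 ≤ Jint N l m ψ w k x y ∧
    Jint N l m ψ w k x y ≤ (Q ^ 2 * (2 * (P ^ m * l ^ (-m))) * Λ * 4) * domF N s (ball x₀ r) (x, y) := by
  have hP := hψ.P0
  have hD := domF_nonneg N s (ball x₀ r) (x, y)
  unfold Jint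
  rcases eq_or_ne x y with h | hne
  · subst h
    simp; positivity
  have hk0 := hw.k0 x y hne
  have h3 := hw.k1 x y hne
  have h4 := kap_ball N s r x₀ x y hr hr1 hx hy
  have hb : ∀ z ∈ ball x₀ r, 0 ≤ ψ z ^ m * (w z + l) ^ (-m) ∧ ψ z ^ m * (w z + l) ^ (-m) ≤ P ^ m * l ^ (-m) := by
    intro z hz
    have h0 := hw.w0 z hz
    have h1 : ψ z ^ m ≤ P ^ m := Real.rpow_le_rpow (hψ.nn z) (hψ.le z) hm.le
    have h2 := rpow_neg_le m l (w z + l) hm.le hl (by linarith)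
    have h3 : 0 ≤ ψ z ^ m := Real.rpow_nonneg (hψ.nn z) _
    have h4 : 0 ≤ (w z + l) ^ (-m) := Real.rpow_nonneg (by linarith) _
    exact ⟨by positivity, by gcongr⟩
  obtain ⟨a1, a2⟩ := hb x hx
  obtain ⟨b1, b2⟩ := hb y hy
  have hsq : (ψ x - ψ y) ^ 2 ≤ Q ^ 2 * ‖x - y‖ ^ 2 := by
    rw [← mul_pow, ← sq_abs (ψ x - ψ y)]
    have := hψ.lip x y
    gcongr
  refine ⟨by positivity, ?_⟩
  calc _ ≤ (Q ^ 2 * ‖x - y‖ ^ 2) * (2 * (P ^ m * l ^ (-m))) * (Λ * ‖x - y‖ ^ (-((N : ℝ) + 2 * s))) := by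
        gcongr; linarith
    _ = (Q ^ 2 * (2 * (P ^ m * l ^ (-m))) * Λ) * (‖x - y‖ ^ 2 * ‖x - y‖ ^ (-((N : ℝ) + 2 * s))) := by ring
    _ ≤ (Q ^ 2 * (2 * (P ^ m * l ^ (-m))) * Λ) * (4 * domF N s (ball x₀ r) (x, y)) := by gcongr
    _ = _ := by ring

lemma Jint_meas {N : ℕ} (l m : ℝ) (ψ w : E N → ℝ) (k : E N → E N → ℝ) (hψ : Measurable ψ) (hw : Measurable w)
    (hk : Measurable (fun p : E N × E N => k p.1 p.2)) :
    Measurable (fun p : E N × E N => Jint N l m ψ w k p.1 p.2) := by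
  unfold Jint
  fun_prop

lemma W_bound {N : ℕ} {s Λ : ℝ} {x₀ : E N} {r M P Q d l m : ℝ} {ψ w : E N → ℝ}
    {k : E N → E N → ℝ} (hw : SpOK N s Λ x₀ r M w k) (hψ : PsiOK N x₀ r P Q d ψ)
    (hl : 0 < l) (hm : 0 < m) (x : E N) (hx : x ∈ ball x₀ r) :
    0 ≤ (w x + l) ^ (-m) * ψ x ^ (m + 2) ∧ (w x + l) ^ (-m) * ψ x ^ (m + 2) ≤ l ^ (-m) * P ^ (m + 2) := by
  have h0 := hw.w0 x hx
  have h1 : ψ x ^ (m + 2) ≤ P ^ (m + 2) := Real.rpow_le_rpow (hψ.nn x) (hψ.le x) (by linarith)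
  have h2 := rpow_neg_le m l (w x + l) hm.le hl (by linarith)
  have h3 : 0 ≤ ψ x ^ (m + 2) := Real.rpow_nonneg (hψ.nn x) _
  have h4 : 0 ≤ (w x + l) ^ (-m) := Real.rpow_nonneg (by linarith) _
  exact ⟨by positivity, by gcongr⟩

lemma nonlocal_ineq {N : ℕ} (hN : 2 ≤ N) {s Λ : ℝ} (hs : s ∈ Set.Ioo (0 : ℝ) 1)  (hΛ : 0 ≤ Λ) {x₀ : E N}
    {r R M P Q d l m Lw S1 S2 : ℝ} {ψ w : E N → ℝ}
    {k : E N → E N → ℝ} (hr : 0 < r) (hr1 : r ≤ 1) (hrR : r < R)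
    (hw : SpOK N s Λ x₀ r M w k) (hψ : PsiOK N x₀ r P Q d ψ)
    (hl : 0 < l) (hm : 0 < m) (hLw0 : 0 ≤ Lw)
    (hLw : ∀ x ∈ ball x₀ r, ∀ y ∈ ball x₀ r, |w x - w y| ≤ Lw * ‖x - y‖)
    (hwR : ∀ x ∈ ball x₀ R, 0 ≤ w x)
    (hS1 : ∀ x ∈ tsupport ψ, ∫ y in (ball x₀ r)ᶜ, ‖x - y‖ ^ (-((N : ℝ) + 2 * s)) ≤ S1)
    (hS2 : ∀ x ∈ tsupport ψ, ∫ y in (ball x₀ R)ᶜ, max (-w y) 0 * ‖x - y‖ ^ (-((N : ℝ) + 2 * s)) ≤ S2) :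
    ∫ x, ∫ y, (w x - w y) * (fe N l m 0 ψ w x - fe N l m 0 ψ w y) * k x y ≤
      2 * max 4 ((6 * m + 1) / 2) * (∫ x in ball x₀ r, ∫ y in ball x₀ r, Jint N l m ψ w k x y) +
      2 * Λ * (S1 + S2 / l) * ∫ x in ball x₀ r, (w x + l) ^ (-m) * ψ x ^ (m + 2) := by
  have hP := hψ.P0
  have hd := hψ.d0
  have hψm := hψ.cont.measurable
  have hwm := hw.wm
  have hkm := hw.km
  set B := ball x₀ r with hBdef
  have hBm : MeasurableSet B := measurableSet_ball
  have hM : 0 ≤ M := (abs_nonneg _).trans (hw.wb x₀)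
  set F : E N × E N → ℝ := fun p => (w p.1 - w p.2) * (fe N l m 0 ψ w p.1 - fe N l m 0 ψ w p.2) * k p.1 p.2 with hF
  have hfm := fe_meas l m 0 ψ w hψm hwm
  obtain ⟨C, hC0, hC⟩ := dom_bound N s Λ hΛ x₀ r M P Q d l m Lw ψ hr hr1 hψ hl hm hLw0
  have hFi : Integrable F (volume.prod volume) :=
    int_of_dom N hN s hs x₀ r C F (by rw [hF]; fun_prop)
      (fun p => hC w k 0 hw le_rfl zero_le_one hLw p.1 p.2)
  set W : E N → ℝ := fun x => (w x + l) ^ (-m) * ψ x ^ (m + 2) with hW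
  have hWm : Measurable W := by rw [hW]; fun_prop
  -- U1
  set U1 : E N × E N → ℝ := (B ×ˢ B).indicator (fun p => Jint N l m ψ w k p.1 p.2) with hU1
  have hJm := Jint_meas l m ψ w k hψm hwm hkm
  have hU1i : Integrable U1 (volume.prod volume) := by
    refine int_of_dom N hN s hs x₀ r (Q ^ 2 * (2 * (P ^ m * l ^ (-m))) * Λ * 4) U1
      (hJm.indicator (hBm.prod hBm)) fun p => ?_
    have hD := domF_nonneg N s (ball x₀ r) p
    by_cases hp : p ∈ B ×ˢ B
    · rw [hU1, indicator_of_mem hp]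
      obtain ⟨h1, h2⟩ := Jint_bound hΛ hr hr1 hw hψ hl hm p.1 p.2 hp.1 hp.2
      rw [abs_of_nonneg h1]; exact h2
    · rw [hU1, indicator_of_notMem hp]; simp; positivity
  -- V
  set g : E N × E N → ℝ := fun p => W p.1 * ((1 + max (-w p.2) 0 / l) * (Λ * ‖p.1 - p.2‖ ^ (-((N : ℝ) + 2 * s)))) with hg
  have hgm : Measurable g := by rw [hg]; fun_prop
  set V : E N × E N → ℝ := (B ×ˢ Bᶜ).indicator g with hV
  have hneg : ∀ y, max (-w y) 0 ≤ M := fun y => max_le (by have := (abs_le.1 (hw.wb y)).1; linarith) hM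
  have hg0 : ∀ p ∈ B ×ˢ Bᶜ, 0 ≤ g p := by
    intro p hp
    have h1 := (W_bound hw hψ hl hm p.1 hp.1).1
    rw [hg]; simp only [hW]; positivity
  have hV0 : ∀ p, 0 ≤ V p := by
    intro p; exact indicator_nonneg hg0 p
  have hVi : Integrable V (volume.prod volume) := by
    refine int_of_dom N hN s hs x₀ r ((l ^ (-m) * P ^ (m + 2)) * ((1 + M / l) * (Λ * (d ^ 2)⁻¹))) V
      (hgm.indicator (hBm.prod hBm.compl)) fun p => ?_
    have hD := domF_nonneg N s (ball x₀ r) p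
    rw [abs_of_nonneg (hV0 p)]
    by_cases hp : p ∈ B ×ˢ Bᶜ
    · rw [hV, indicator_of_mem hp]
      obtain ⟨h1, h2⟩ := W_bound hw hψ hl hm p.1 hp.1
      by_cases hz : ψ p.1 = 0
      · have : W p.1 = 0 := by
          simp only [hW, hz]; rw [Real.zero_rpow (by linarith)]; simp
        simp only [hg, this, zero_mul]; positivity
      have h3 := kap_off N s d hψ.d0 hψ.d1 _ (hψ.dist' p.1 hz p.2 hp.2)
      have h4 := domF_left N s B p.1 p.2 hp.1
      calc g p ≤ (l ^ (-m) * P ^ (m + 2)) * ((1 + M / l) * (Λ * ((d ^ 2)⁻¹ * domF N s B (p.1, p.2)))) := by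
            simp only [hg, hW]
            have := hneg p.2
            gcongr
            refine h3.trans ?_
            gcongr
        _ = _ := by ring
    · rw [hV, indicator_of_notMem hp]; positivity
  have hVsi : Integrable (V ∘ Prod.swap) (volume.prod volume) := hVi.swap
  -- pointwise
  have hone : ∀ x y, x ∈ B → y ∉ B → F (x, y) ≤ V (x, y) := by
    intro x y hx hy
    have hne : x ≠ y := fun h => hy (h ▸ hx)
    have hfy : fe N l m 0 ψ w y = 0 := by simp [fe, hψ.supp y hy, Psi_at_zero]
    rw [hV, indicator_of_mem (show (x, y) ∈ B ×ˢ Bᶜ from ⟨hx, hy⟩)]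
    simp only [hF, hg, hfy, sub_zero, hW]
    simp only [fe, Psi_zero' m _ hm]
    have hx0 := hw.w0 x hx
    have hv : 0 < w x + l := by linarith
    have h1 := hw.k1 x y hne
    have h0 := hw.k0 x y hne
    have e : (w x + l) ^ (-m - 1) = (w x + l) ^ (-m) / (w x + l) := Real.rpow_sub_one hv.ne' _
    have hp1 : 0 ≤ (w x + l) ^ (-m) := Real.rpow_nonneg hv.le _
    have hp2 : 0 ≤ ψ x ^ (m + 2) := Real.rpow_nonneg (hψ.nn x) _
    have h2 : w x - w y ≤ (w x + l) * (1 + max (-w y) 0 / l) := by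
      have h3 : -w y ≤ max (-w y) 0 := le_max_left _ _
      have h4 : (0:ℝ) ≤ max (-w y) 0 := le_max_right _ _
      have h5 : (w x + l) * (1 + max (-w y) 0 / l) = w x + l + w x * (max (-w y) 0 / l) + max (-w y) 0 := by
        field_simp; ring
      have h6 : 0 ≤ w x * (max (-w y) 0 / l) := by positivity
      linarith
    rw [e]
    calc _ ≤ ((w x + l) * (1 + max (-w y) 0 / l)) * ((w x + l) ^ (-m) / (w x + l) * ψ x ^ (m + 2)) * k x y := by gcongr
      _ ≤ ((w x + l) * (1 + max (-w y) 0 / l)) * ((w x + l) ^ (-m) / (w x + l) * ψ x ^ (m + 2)) *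
        (Λ * ‖x - y‖ ^ (-((N : ℝ) + 2 * s))) := by gcongr
      _ = _ := by field_simp
  set c := 2 * max 4 ((6 * m + 1) / 2) with hc
  have hc0 : 0 ≤ c := by positivity
  have hpt : ∀ p, F p ≤ c * U1 p + V p + (V ∘ Prod.swap) p := by
    rintro ⟨x, y⟩
    simp only [Function.comp, Prod.swap_prod_mk]
    have hVa := hV0 (x, y)
    have hVb := hV0 (y, x)
    by_cases hx : x ∈ B <;> by_cases hy : y ∈ B
    · rw [hU1, indicator_of_mem (show (x, y) ∈ B ×ˢ B from ⟨hx, hy⟩)]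
      have hJ : F (x, y) ≤ c * Jint N l m ψ w k x y := by
        rcases eq_or_ne x y with h | hne
        · subst h; simp [hF, Jint]
        have h0 := hw.k0 x y hne
        have := alg_ineq m (w x + l) (w y + l) (ψ x) (ψ y) hm (by linarith [hw.w0 x hx]) (by linarith [hw.w0 y hy])
          (hψ.nn x) (hψ.nn y)
        rw [← hc] at this
        have h2 := mul_le_mul_of_nonneg_right this h0
        simp only [hF, fe, Psi_zero' m _ hm, Jint]
        rw [show w x + l - (w y + l) = w x - w y by ring] at h2
        linarith
      linarith
    · have hu : U1 (x, y) = 0 := indicator_of_notMem (fun h => hy h.2) _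
      have := hone x y hx hy
      rw [hu]; linarith
    · have hu : U1 (x, y) = 0 := indicator_of_notMem (fun h => hx h.1) _
      have h1 := hone y x hy hx
      have h2 : F (x, y) = F (y, x) := by simp only [hF]; rw [hw.ks x y]; ring
      rw [hu]; linarith
    · have hu : U1 (x, y) = 0 := indicator_of_notMem (fun h => hx h.1) _
      have : F (x, y) = 0 := by simp [hF, fe, hψ.supp y hy, hψ.supp x hx, Psi_at_zero]
      rw [hu, this]; linarith
  have hmain : ∫ p, F p ∂(volume.prod volume) ≤ c * ∫ p, U1 p ∂(volume.prod volume) + 2 * ∫ p, V p ∂(volume.prod volume) := by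
    calc _ ≤ ∫ p, (c * U1 p + V p + (V ∘ Prod.swap) p) ∂(volume.prod volume) :=
          integral_mono hFi (((hU1i.const_mul c).add hVi).add hVsi) hpt
      _ = _ := by
        rw [integral_add (f := fun p => c * U1 p + V p) ((hU1i.const_mul c).add hVi) hVsi,
          integral_add (f := fun p => c * U1 p) (hU1i.const_mul c) hVi, integral_const_mul]
        have : ∫ p, (V ∘ Prod.swap) p ∂(volume.prod volume) = ∫ p, V p ∂(volume.prod volume) :=
          integral_prod_swap (μ := volume) (ν := volume) V
        rw [this]; ring
  have e1 : ∫ p, F p ∂(volume.prod volume) = ∫ x, ∫ y, (w x - w y) * (fe N l m 0 ψ w x - fe N l m 0 ψ w y) * k x y :=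
    integral_prod F hFi
  have e2 : ∫ p, U1 p ∂(volume.prod volume) = ∫ x in B, ∫ y in B, Jint N l m ψ w k x y := by
    rw [hU1, integral_indicator (hBm.prod hBm), setIntegral_prod]
    exact (integrable_indicator_iff (hBm.prod hBm)).1 hU1i
  have hgi : IntegrableOn g (B ×ˢ Bᶜ) (volume.prod volume) := (integrable_indicator_iff (hBm.prod hBm.compl)).1 hVi
  have e3 : ∫ p, V p ∂(volume.prod volume) = ∫ x in B, ∫ y in Bᶜ, g (x, y) := by
    rw [hV, integral_indicator (hBm.prod hBm.compl), setIntegral_prod _ hgi]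
  have hWi : IntegrableOn W B := by
    refine IntegrableOn.of_bound measure_ball_lt_top hWm.aestronglyMeasurable (l ^ (-m) * P ^ (m + 2)) ?_
    refine (ae_restrict_iff' hBm).2 (ae_of_all _ fun x hx => ?_)
    obtain ⟨h1, h2⟩ := W_bound hw hψ hl hm x hx
    rw [Real.norm_eq_abs, abs_of_nonneg h1]; exact h2
  have e4 : ∫ x in B, ∫ y in Bᶜ, g (x, y) ≤ Λ * (S1 + S2 / l) * ∫ x in B, W x := by
    rw [← integral_const_mul]
    refine setIntegral_mono_on ?_ (hWi.const_mul _) hBm fun x hx => ?_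
    · have : Integrable g ((volume.restrict B).prod (volume.restrict Bᶜ)) := by
        rw [Measure.prod_restrict]; exact hgi
      exact this.integral_prod_left
    · simp only [hg]
      rw [integral_const_mul, mul_comm _ (W x)]
      by_cases hz : ψ x = 0
      · have : W x = 0 := by
          simp only [hW, hz]; rw [Real.zero_rpow (by linarith)]; simp
        simp [this]
      have hxs : x ∈ tsupport ψ := subset_tsupport _ hz
      refine mul_le_mul_of_nonneg_left ?_ (W_bound hw hψ hl hm x hx).1
      obtain ⟨i1, -⟩ := tail_integrable N hN s hs d hψ.d0 hψ.d1 x Bᶜ hBm.compl (fun y hy => hψ.dist x hxs y hy)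
      obtain ⟨i2, -⟩ := tail_integrable_mul N hN s hs d M hψ.d0 hψ.d1 x Bᶜ hBm.compl (fun y hy => hψ.dist x hxs y hy)
        (fun y => max (-w y) 0) (by fun_prop) (fun y => by rw [abs_of_nonneg (le_max_right _ _)]; exact hneg y)
      have e5 : ∫ y in Bᶜ, (1 + max (-w y) 0 / l) * (Λ * ‖x - y‖ ^ (-((N : ℝ) + 2 * s))) =
          Λ * ((∫ y in Bᶜ, ‖x - y‖ ^ (-((N : ℝ) + 2 * s))) +
            (∫ y in Bᶜ, max (-w y) 0 * ‖x - y‖ ^ (-((N : ℝ) + 2 * s))) / l) := by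
        rw [← integral_div, ← integral_add i1 (i2.div_const l), ← integral_const_mul]
        congr 1; ext y; ring
      have e6 : ∫ y in Bᶜ, max (-w y) 0 * ‖x - y‖ ^ (-((N : ℝ) + 2 * s)) =
          ∫ y in (ball x₀ R)ᶜ, max (-w y) 0 * ‖x - y‖ ^ (-((N : ℝ) + 2 * s)) := by
        refine setIntegral_eq_of_subset_of_forall_sdiff_eq_zero hBm.compl
          (compl_subset_compl.2 (ball_subset_ball hrR.le)) fun y hy => ?_
        have hyR : y ∈ ball x₀ R := by simpa using hy.2
        rw [max_eq_right (by linarith [hwR y hyR]), zero_mul]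
      rw [e5, e6]
      have := hS1 x hxs
      have := hS2 x hxs
      gcongr
  rw [e1, e2, e3] at hmain
  refine hmain.trans ?_
  have : 2 * Λ * (S1 + S2 / l) * ∫ x in B, W x = 2 * (Λ * (S1 + S2 / l) * ∫ x in B, W x) := by ring
  rw [this]
  gcongr


lemma fe_hasGradient {N : ℕ} {l m ε : ℝ} {ψ w : E N → ℝ} {x gw gψ : E N} (hm : 0 < m)
    (hw : HasGradientAt w gw x) (hψ : HasGradientAt ψ gψ x) (hv : w x + l ≠ 0) :
    HasGradientAt (fe N l m ε ψ w) (((w x + l) ^ (-m - 1) * ((m + 2) * (ψ x + ε) ^ (m + 1))) • gψ +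
      (Psi m ε (ψ x) * ((-m - 1) * (w x + l) ^ (-m - 2))) • gw) x := by
  rw [hasGradientAt_iff_hasFDerivAt] at *
  have h1 : HasFDerivAt (fun y => (w y + l) ^ (-m - 1))
      (((-m - 1) * (w x + l) ^ (-m - 1 - 1)) • (InnerProductSpace.toDual ℝ (E N) gw)) x :=
    (hw.add_const l).rpow_const (Or.inl hv)
  have h2 : HasFDerivAt (fun y => Psi m ε (ψ y))
      (((m + 2) * (ψ x + ε) ^ (m + 2 - 1)) • (InnerProductSpace.toDual ℝ (E N) gψ)) x := by
    unfold Psi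
    exact ((hψ.add_const ε).rpow_const (Or.inr (by linarith))).sub_const _
  have h3 := h1.mul h2
  have e : (fe N l m ε ψ w) = fun y => (w y + l) ^ (-m - 1) * Psi m ε (ψ y) := rfl
  rw [e]
  refine h3.congr_fderiv ?_
  rw [map_add, map_smulₛₗ, map_smulₛₗ, smul_smul, smul_smul]
  simp only [conj_trivial]
  rw [show m + 2 - 1 = m + 1 by ring, show -m - 1 - 1 = -m - 2 by ring]

def Gint (N : ℕ) (l m ε : ℝ) (ψ w : E N → ℝ) (x : E N) : ℝ :=
  ((w x + l) ^ (-m - 1) * ((m + 2) * (ψ x + ε) ^ (m + 1))) * ⟪gradient w x, gradient ψ x⟫ +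
      (Psi m ε (ψ x) * ((-m - 1) * (w x + l) ^ (-m - 2))) * ‖gradient w x‖ ^ 2

lemma Gint_eq {N : ℕ} {l m ε : ℝ} {ψ w : E N → ℝ} {x : E N} (hm : 0 < m) (c : ℝ)
    (hw : DifferentiableAt ℝ w x) (hψ : DifferentiableAt ℝ ψ x) (hv : w x + l ≠ 0) :
    ⟪gradient w x, gradient (fun y => fe N l m ε ψ w y * c) x⟫ = Gint N l m ε ψ w x * c := by
  have h := fe_hasGradient (l := l) (ε := ε) hm hw.hasGradientAt hψ.hasGradientAt hv
  have h2 : HasGradientAt (fun y => fe N l m ε ψ w y * c) (c • (((w x + l) ^ (-m - 1) * ((m + 2) * (ψ x + ε) ^ (m + 1))) • gradient ψ x +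
      (Psi m ε (ψ x) * ((-m - 1) * (w x + l) ^ (-m - 2))) • gradient w x)) x := by
    rw [hasGradientAt_iff_hasFDerivAt] at *
    refine (h.mul_const c).congr_fderiv ?_
    rw [map_smulₛₗ]; simp
  rw [h2.gradient, inner_smul_right, inner_add_right, inner_smul_right, inner_smul_right, real_inner_self_eq_norm_sq]
  unfold Gint; ring

lemma grad_rpow {N : ℕ} {l q : ℝ} {w : E N → ℝ} {x : E N}
    (hw : DifferentiableAt ℝ w x) (hv : w x + l ≠ 0) :
    gradient (fun y => (w y + l) ^ q) x = (q * (w x + l) ^ (q - 1)) • gradient w x := by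
  have h := hw.hasGradientAt
  rw [hasGradientAt_iff_hasFDerivAt] at h
  have h1 : HasFDerivAt (fun y => (w y + l) ^ q)
      ((q * (w x + l) ^ (q - 1)) • (InnerProductSpace.toDual ℝ (E N) (gradient w x))) x :=
    (h.add_const l).rpow_const (Or.inl hv)
  apply HasGradientAt.gradient
  rw [hasGradientAt_iff_hasFDerivAt]
  refine h1.congr_fderiv ?_
  rw [map_smulₛₗ]; simp

lemma Gint_ineq {N : ℕ} {l m : ℝ} {ψ w : E N → ℝ} {x : E N} (hm : 0 < m)
    (hw : DifferentiableAt ℝ w x) (hv : 0 < w x + l) (hψ0 : 0 ≤ ψ x) :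
    2 * (m + 1) / m ^ 2 * (‖gradient (fun y => (w y + l) ^ (-(m / 2))) x‖ ^ 2 * ψ x ^ (m + 2)) +
    Gint N l m 0 ψ w x ≤
      (m + 2) ^ 2 / (2 * (m + 1)) * (‖gradient ψ x‖ ^ 2 * (w x + l) ^ (-m) * ψ x ^ m) := by
  rw [grad_rpow hw hv.ne', norm_smul, mul_pow]
  unfold Gint
  rw [Psi_zero' _ _ hm, add_zero]
  set v := w x + l
  set A := ψ x
  have e1 : v ^ (-m - 1) = v ^ (-m) / v := Real.rpow_sub_one hv.ne' _
  have e2 : v ^ (-m - 2) = v ^ (-m) / v ^ 2 := by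
    rw [Real.rpow_sub hv]; norm_num
  have e3 : ‖-(m / 2) * v ^ (-(m / 2) - 1)‖ ^ 2 = m ^ 2 / 4 * (v ^ (-m) / v ^ 2) := by
    rw [Real.norm_eq_abs, sq_abs, mul_pow, ← e2, ← Real.rpow_natCast (v ^ (-(m / 2) - 1)), ← Real.rpow_mul hv.le]
    rw [show (-(m / 2) - 1) * ((2:ℕ):ℝ) = -m - 2 by push_cast; ring]
    ring
  have e4 : A ^ (m + 2) = A ^ m * A ^ 2 := by
    rcases hψ0.eq_or_lt with h | h
    · rw [← h, Real.zero_rpow (by linarith)]; simp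
    · rw [Real.rpow_add h]; norm_num
  have e5 : A ^ (m + 1) = A ^ m * A := by
    rcases hψ0.eq_or_lt with h | h
    · rw [← h, Real.zero_rpow (by linarith)]; simp
    · rw [Real.rpow_add h]; norm_num
  rw [e1, e2, e3, e4, e5]
  have hvm : 0 ≤ v ^ (-m) := Real.rpow_nonneg hv.le _
  have hAm : 0 ≤ A ^ m := Real.rpow_nonneg hψ0 _
  have hin := real_inner_le_norm (gradient w x) (gradient ψ x)
  set X := ‖gradient w x‖
  set Y := ‖gradient ψ x‖
  set I := ⟪gradient w x, gradient ψ x⟫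
  set V := v ^ (-m)
  set Am := A ^ m
  have h1 : (V / v * ((m + 2) * (Am * A))) * I ≤ (V / v * ((m + 2) * (Am * A))) * (X * Y) := by
    gcongr
  set q := A / v with hq
  have key : (m + 2) * (q * X) * Y ≤ (m + 1) / 2 * (q * X) ^ 2 + (m + 2) ^ 2 / (2 * (m + 1)) * Y ^ 2 := by
    have : (m + 1) / 2 * (q * X) ^ 2 + (m + 2) ^ 2 / (2 * (m + 1)) * Y ^ 2 - (m + 2) * (q * X) * Y =
      ((m + 1) * (q * X) - (m + 2) * Y) ^ 2 / (2 * (m + 1)) := by field_simp; ring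
    have h2 : 0 ≤ ((m + 1) * (q * X) - (m + 2) * Y) ^ 2 / (2 * (m + 1)) := by positivity
    linarith
  have key2 := mul_le_mul_of_nonneg_left key (mul_nonneg hvm hAm)
  have f1 : (V / v * ((m + 2) * (Am * A))) * (X * Y) = V * Am * ((m + 2) * (q * X) * Y) := by
    rw [hq]; field_simp
  have f2 : 2 * (m + 1) / m ^ 2 * (m ^ 2 / 4 * (V / v ^ 2) * X ^ 2 * (Am * A ^ 2)) =
     V * Am * ((m + 1) / 2 * (q * X) ^ 2) := by rw [hq]; field_simp; ring
  have f3 : Am * A ^ 2 * ((-m - 1) * (V / v ^ 2)) * X ^ 2 = - (V * Am * ((m + 1) * (q * X) ^ 2)) := by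
    rw [hq]; field_simp; ring
  rw [f2, f3]
  rw [f1] at h1
  have f4 : (m + 2) ^ 2 / (2 * (m + 1)) * (Y ^ 2 * V * Am) = V * Am * ((m + 2) ^ 2 / (2 * (m + 1)) * Y ^ 2) := by ring
  rw [f4]
  nlinarith [h1, key2]

section ucalc
variable {N : ℕ} {x₀ : E N} {R a b : ℝ} {u : E N → ℝ → ℝ}

lemma u_cda (hu : ContDiffOn ℝ (⊤ : ℕ∞) (fun p : E N × ℝ => u p.1 p.2) (ball x₀ R ×ˢ Ioo a b))
    {x : E N} {t : ℝ} (hx : x ∈ ball x₀ R) (ht : t ∈ Ioo a b) :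
    ContDiffAt ℝ (⊤ : ℕ∞) (fun p : E N × ℝ => u p.1 p.2) (x, t) :=
  hu.contDiffAt ((isOpen_ball.prod isOpen_Ioo).mem_nhds ⟨hx, ht⟩)

lemma u_fd (hu : ContDiffOn ℝ (⊤ : ℕ∞) (fun p : E N × ℝ => u p.1 p.2) (ball x₀ R ×ˢ Ioo a b))
    {x : E N} {t : ℝ} (hx : x ∈ ball x₀ R) (ht : t ∈ Ioo a b) :
    HasFDerivAt (fun y => u y t) ((fderiv ℝ (fun p : E N × ℝ => u p.1 p.2) (x, t)).comp (ContinuousLinearMap.inl ℝ (E N) ℝ)) x := by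
  have h := ((u_cda hu hx ht).differentiableAt (by simp)).hasFDerivAt
  have h2 : HasFDerivAt (fun y : E N => (y, t)) (ContinuousLinearMap.inl ℝ (E N) ℝ) x := hasFDerivAt_prodMk_left x t
  exact h.comp x h2

lemma u_dt (hu : ContDiffOn ℝ (⊤ : ℕ∞) (fun p : E N × ℝ => u p.1 p.2) (ball x₀ R ×ˢ Ioo a b))
    {x : E N} {t : ℝ} (hx : x ∈ ball x₀ R) (ht : t ∈ Ioo a b) :
    DifferentiableAt ℝ (fun τ => u x τ) t := by
  have h := ((u_cda hu hx ht).differentiableAt (by simp)).hasFDerivAt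
  have h2 : HasFDerivAt (fun y : ℝ => (x, y)) (ContinuousLinearMap.inr ℝ (E N) ℝ) t := hasFDerivAt_prodMk_right x t
  exact (h.comp t h2).differentiableAt

lemma u_grad_cont (hu : ContDiffOn ℝ (⊤ : ℕ∞) (fun p : E N × ℝ => u p.1 p.2) (ball x₀ R ×ˢ Ioo a b)) :
    ContinuousOn (fun p : E N × ℝ => gradient (fun y => u y p.2) p.1) (ball x₀ R ×ˢ Ioo a b) := by
  have h1 := hu.continuousOn_fderiv_of_isOpen (isOpen_ball.prod isOpen_Ioo) (by simp)
  have h2 : ContinuousOn (fun p : E N × ℝ => (InnerProductSpace.toDual ℝ (E N)).symm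
     ((fderiv ℝ (fun p : E N × ℝ => u p.1 p.2) p).comp (ContinuousLinearMap.inl ℝ (E N) ℝ))) (ball x₀ R ×ˢ Ioo a b) := by
    refine (LinearIsometryEquiv.continuous _).comp_continuousOn ?_
    exact h1.clm_comp continuousOn_const
  refine h2.congr fun p hp => ?_
  simp only [gradient]
  rw [(u_fd hu hp.1 hp.2).fderiv]

lemma u_lip (hu : ContDiffOn ℝ (⊤ : ℕ∞) (fun p : E N × ℝ => u p.1 p.2) (ball x₀ R ×ˢ Ioo a b))
   {r : ℝ} (hrR : r < R) {S : Set ℝ} (hS : IsCompact S) (hSab : S ⊆ Ioo a b) :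
   ∃ L : ℝ, 0 ≤ L ∧ (∀ t ∈ S, ∀ x ∈ ball x₀ r, ‖gradient (fun y => u y t) x‖ ≤ L) ∧
    ∀ t ∈ S, ∀ x ∈ ball x₀ r, ∀ y ∈ ball x₀ r, |u x t - u y t| ≤ L * ‖x - y‖ := by
  have hsub : closedBall x₀ r ×ˢ S ⊆ ball x₀ R ×ˢ Ioo a b := prod_mono (closedBall_subset_ball hrR) hSab
  obtain ⟨L, hL⟩ := ((isCompact_closedBall x₀ r).prod hS).exists_bound_of_continuousOn ((u_grad_cont hu).mono hsub)
  have hL' : ∀ t ∈ S, ∀ x ∈ ball x₀ r, ‖gradient (fun y => u y t) x‖ ≤ max L 0 := fun t ht x hx =>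
    (hL (x, t) ⟨ball_subset_closedBall hx, ht⟩).trans (le_max_left _ _)
  refine ⟨max L 0, le_max_right _ _, hL', fun t ht x hx y hy => ?_⟩
  have := (convex_ball x₀ r).norm_image_sub_le_of_norm_fderiv_le (𝕜 := ℝ) (f := fun y => u y t) (C := max L 0)
    (fun z hz => (u_fd hu (ball_subset_ball hrR.le hz) (hSab ht)).differentiableAt)
    (fun z hz => by
      have := hL' t ht z hz
      simpa [gradient] using this) hy hx
  simpa using this
end ucalc


structure Dat (N : ℕ) (s Λ a b M : ℝ) (x₀ : E N) (R r l m P Q d : ℝ) (ψ : E N → ℝ)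
    (u : E N → ℝ → ℝ) (K : E N → E N → ℝ → ℝ) : Prop where
  hN : 2 ≤ N
  hs : s ∈ Ioo (0:ℝ) 1
  hΛ : 0 ≤ Λ
  hr : 0 < r
  hr1 : r ≤ 1
  hrR : r < R
  hl : 0 < l
  hm : 0 < m
  um : Measurable (fun p : E N × ℝ => u p.1 p.2)
  ub : ∀ t ∈ Ioo a b, ∀ x, |u x t| ≤ M
  u0 : ∀ t ∈ Ioo a b, ∀ x ∈ ball x₀ R, 0 ≤ u x t
  us : ContDiffOn ℝ (⊤ : ℕ∞) (fun p : E N × ℝ => u p.1 p.2) (ball x₀ R ×ˢ Ioo a b)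
  Km : Measurable (fun p : E N × E N × ℝ => K p.1 p.2.1 p.2.2)
  Ks : ∀ x y t, K x y t = K y x t
  K0 : ∀ t ∈ Ioo a b, ∀ x y, x ≠ y → 0 ≤ K x y t
  K1 : ∀ t ∈ Ioo a b, ∀ x y, x ≠ y → K x y t ≤ Λ * ‖x - y‖ ^ (-((N : ℝ) + 2 * s))
  ψs : ContDiff ℝ (⊤ : ℕ∞) ψ
  ψc : HasCompactSupport ψ
  ψsupp : tsupport ψ ⊆ ball x₀ r
  ψok : PsiOK N x₀ r P Q d ψ

structure Th (a b : ℝ) (θ : ℝ → ℝ) : Prop where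
  sm : ContDiff ℝ (⊤ : ℕ∞) θ
  nn : ∀ t, 0 ≤ θ t
  cs : HasCompactSupport θ
  ts : tsupport θ ⊆ Ioo a b

section dat
variable {N : ℕ} {s Λ a b M : ℝ} {x₀ : E N} {R r l m P Q d : ℝ} {ψ : E N → ℝ}
    {u : E N → ℝ → ℝ} {K : E N → E N → ℝ → ℝ} {θ : ℝ → ℝ}

lemma Dat.sp (D : Dat N s Λ a b M x₀ R r l m P Q d ψ u K) {t : ℝ} (ht : t ∈ Ioo a b) :
    SpOK N s Λ x₀ r M (fun y => u y t) (fun x y => K x y t) where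
  wm := D.um.comp (by fun_prop : Measurable fun x : E N => (x, t))
  wb := D.ub t ht
  w0 := fun x hx => D.u0 t ht x (ball_subset_ball D.hrR.le hx)
  km := D.Km.comp (by fun_prop : Measurable fun p : E N × E N => (p.1, p.2, t))
  ks := fun x y => D.Ks x y t
  k0 := D.K0 t ht
  k1 := D.K1 t ht

lemma Dat.vpos (D : Dat N s Λ a b M x₀ R r l m P Q d ψ u K) {t : ℝ} (ht : t ∈ Ioo a b) {x : E N}
    (hx : x ∈ ball x₀ R) : 0 < u x t + l := by
  have := D.u0 t ht x hx; have := D.hl; linarith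

lemma Dat.psi0 (D : Dat N s Λ a b M x₀ R r l m P Q d ψ u K) {x : E N}
    (hx : x ∉ ball x₀ r) : ψ x = 0 := D.ψok.supp x hx

def phi (N : ℕ) (l m ε : ℝ) (ψ : E N → ℝ) (u : E N → ℝ → ℝ) (θ : ℝ → ℝ) (x : E N) (t : ℝ) : ℝ :=
  fe N l m ε ψ (fun y => u y t) x * θ t

lemma phi_zero {ε : ℝ} {x : E N} {t : ℝ} (h : ψ x = 0 ∨ θ t = 0) : phi N l m ε ψ u θ x t = 0 := by
  unfold phi fe
  rcases h with h | h <;> simp [h, Psi_at_zero]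

lemma phi_tsupport {ε : ℝ} : tsupport (fun p : E N × ℝ => phi N l m ε ψ u θ p.1 p.2) ⊆ tsupport ψ ×ˢ tsupport θ := by
  refine closure_minimal ?_ ((isClosed_tsupport _).prod (isClosed_tsupport _))
  intro p hp
  rw [Function.mem_support] at hp
  constructor
  · exact subset_tsupport _ (fun h => hp (phi_zero (Or.inl h)))
  · exact subset_tsupport _ (fun h => hp (phi_zero (Or.inr h)))

lemma phi_compact (D : Dat N s Λ a b M x₀ R r l m P Q d ψ u K) (hθ : Th a b θ) {ε : ℝ} :
    HasCompactSupport (fun p : E N × ℝ => phi N l m ε ψ u θ p.1 p.2) :=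
  IsCompact.of_isClosed_subset (D.ψc.isCompact.prod hθ.cs.isCompact) (isClosed_tsupport _) phi_tsupport

lemma phi_tsupport' (D : Dat N s Λ a b M x₀ R r l m P Q d ψ u K) (hθ : Th a b θ) {ε : ℝ} :
    tsupport (fun p : E N × ℝ => phi N l m ε ψ u θ p.1 p.2) ⊆ ball x₀ R ×ˢ Ioo a b :=
  phi_tsupport.trans (prod_mono (D.ψsupp.trans (ball_subset_ball D.hrR.le)) hθ.ts)

lemma phi_smooth (D : Dat N s Λ a b M x₀ R r l m P Q d ψ u K) (hθ : Th a b θ) {ε : ℝ} (hε : 0 < ε) :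
    ContDiff ℝ (⊤ : ℕ∞) (fun p : E N × ℝ => phi N l m ε ψ u θ p.1 p.2) := by
  rw [contDiff_iff_contDiffAt]
  rintro p
  by_cases hp : p ∈ tsupport (fun p : E N × ℝ => phi N l m ε ψ u θ p.1 p.2)
  · have hp' := phi_tsupport' D hθ hp
    have h1 : ContDiffAt ℝ (⊤ : ℕ∞) (fun p : E N × ℝ => (u p.1 p.2 + l) ^ (-m - 1)) p :=
      ContDiffAt.rpow_const_of_ne ((u_cda D.us hp'.1 hp'.2).add contDiffAt_const) (D.vpos hp'.2 hp'.1).ne'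
    have h2 : ContDiffAt ℝ (⊤ : ℕ∞) (fun p : E N × ℝ => Psi m ε (ψ p.1)) p := by
      unfold Psi
      refine ContDiffAt.sub (ContDiffAt.rpow_const_of_ne ?_ ?_) contDiffAt_const
      · exact (D.ψs.contDiffAt.comp p contDiffAt_fst).add contDiffAt_const
      · have := D.ψok.nn p.1; positivity
    have h3 : ContDiffAt ℝ (⊤ : ℕ∞) (fun p : E N × ℝ => θ p.2) p :=
      hθ.sm.contDiffAt.comp p contDiffAt_snd
    exact (h1.mul h2).mul h3
  · have : (fun p : E N × ℝ => phi N l m ε ψ u θ p.1 p.2) =ᶠ[𝓝 p] fun _ => 0 :=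
      notMem_tsupport_iff_eventuallyEq.1 hp
    exact contDiffAt_const.congr_of_eventuallyEq this

lemma phi_nonneg (D : Dat N s Λ a b M x₀ R r l m P Q d ψ u K) (hθ : Th a b θ) {ε : ℝ} (hε : 0 ≤ ε) (x : E N) (t : ℝ) :
    0 ≤ phi N l m ε ψ u θ x t := by
  by_cases ht : θ t = 0
  · exact (phi_zero (Or.inr ht)).ge
  by_cases hx : ψ x = 0
  · exact (phi_zero (Or.inl hx)).ge
  have ht' := hθ.ts (subset_tsupport _ ht)
  have hx' : x ∈ ball x₀ R := by
    by_contra h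
    exact hx (D.psi0 fun h' => h (ball_subset_ball D.hrR.le h'))
  unfold phi fe
  have := D.vpos ht' hx'
  have := Psi_nonneg m ε (ψ x) D.hm hε (D.ψok.nn x)
  have := hθ.nn t
  positivity

/-- time derivative of the test function -/
def dphi (N : ℕ) (l m ε : ℝ) (ψ : E N → ℝ) (u : E N → ℝ → ℝ) (θ : ℝ → ℝ) (x : E N) (t : ℝ) : ℝ :=
  deriv (fun τ => phi N l m ε ψ u θ x τ) t

lemma dphi_eq (D : Dat N s Λ a b M x₀ R r l m P Q d ψ u K) (hθ : Th a b θ) {ε : ℝ} (hε : 0 < ε) :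
    (fun p : E N × ℝ => dphi N l m ε ψ u θ p.1 p.2) = fun p =>
      fderiv ℝ (fun p : E N × ℝ => phi N l m ε ψ u θ p.1 p.2) p (0, 1) := by
  ext ⟨x, t⟩
  have h := ((phi_smooth D hθ hε).contDiffAt.differentiableAt (x := (x, t)) (by simp)).hasFDerivAt
  have h2 : HasFDerivAt (fun y : ℝ => (x, y)) (ContinuousLinearMap.inr ℝ (E N) ℝ) t := hasFDerivAt_prodMk_right x t
  have h3 := (h.comp t h2).hasDerivAt
  have h4 := h3.deriv
  simp only [dphi]
  simpa [Function.comp_def] using h4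

lemma dphi_cont (D : Dat N s Λ a b M x₀ R r l m P Q d ψ u K) (hθ : Th a b θ) {ε : ℝ} (hε : 0 < ε) :
    Continuous (fun p : E N × ℝ => dphi N l m ε ψ u θ p.1 p.2) := by
  rw [dphi_eq D hθ hε]
  exact ((phi_smooth D hθ hε).continuous_fderiv (by simp)).clm_apply continuous_const

lemma dphi_bdd (D : Dat N s Λ a b M x₀ R r l m P Q d ψ u K) (hθ : Th a b θ) {ε : ℝ} (hε : 0 < ε) :
    ∃ C, ∀ x t, |dphi N l m ε ψ u θ x t| ≤ C := by
  have hc : HasCompactSupport (fun p : E N × ℝ => dphi N l m ε ψ u θ p.1 p.2) := by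
    rw [dphi_eq D hθ hε]
    exact HasCompactSupport.fderiv_apply (𝕜 := ℝ) (phi_compact D hθ) _
  obtain ⟨C, hC⟩ := hc.exists_bound_of_continuous (dphi_cont D hθ hε)
  exact ⟨C, fun x t => hC (x, t)⟩

lemma dphi_zero {ε : ℝ} {x : E N} {t : ℝ} (h : ψ x = 0 ∨ t ∉ tsupport θ) : dphi N l m ε ψ u θ x t = 0 := by
  unfold dphi
  rcases h with h | h
  · have : (fun τ => phi N l m ε ψ u θ x τ) = fun _ => 0 := by ext τ; exact phi_zero (Or.inl h)
    rw [this]; simp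
  · have : (fun τ => phi N l m ε ψ u θ x τ) =ᶠ[𝓝 t] fun _ => 0 := by
      filter_upwards [notMem_tsupport_iff_eventuallyEq.1 h] with τ hτ
      exact phi_zero (Or.inr hτ)
    rw [this.deriv_eq]; simp

def Wt (N : ℕ) (l m ε : ℝ) (ψ : E N → ℝ) (u : E N → ℝ → ℝ) (θ : ℝ → ℝ) (x : E N) (t : ℝ) : ℝ :=
  (((m + 1) / m * (u x t + l) ^ (-m) - l * (u x t + l) ^ (-m - 1)) * Psi m ε (ψ x)) * θ t

lemma Wt_deriv (D : Dat N s Λ a b M x₀ R r l m P Q d ψ u K) (hθ : Th a b θ) {ε : ℝ} {x : E N} (hx : x ∈ ball x₀ R) (t : ℝ) :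
    HasDerivAt (Wt N l m ε ψ u θ x) (u x t * dphi N l m ε ψ u θ x t +
      1 / m * ((u x t + l) ^ (-m) * Psi m ε (ψ x) * deriv θ t)) t := by
  by_cases ht : t ∈ tsupport θ
  · have ht' := hθ.ts ht
    have hv := D.vpos ht' hx
    have hm := D.hm
    have hu := ((u_dt D.us hx ht').hasDerivAt).add_const l
    have hθ' := (hθ.sm.contDiffAt.differentiableAt (x := t) (by simp)).hasDerivAt
    have h1 := hu.rpow_const (p := -m) (Or.inl hv.ne')
    have h2 := hu.rpow_const (p := -m - 1) (Or.inl hv.ne')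
    have h3 : HasDerivAt (fun τ => phi N l m ε ψ u θ x τ) _ t := (h2.mul_const (Psi m ε (ψ x))).mul hθ'
    have h4 : HasDerivAt (Wt N l m ε ψ u θ x) _ t :=
      (((h1.const_mul ((m+1)/m)).sub (h2.const_mul l)).mul_const (Psi m ε (ψ x))).mul hθ'
    refine h4.congr_deriv ?_
    unfold dphi
    rw [h3.deriv]
    set v := u x t + l with hvdef
    have eu : u x t = v - l := by rw [hvdef]; ring
    rw [eu]
    have e1 : v ^ (-m - 1) = v ^ (-m) / v := Real.rpow_sub_one hv.ne' _
    have e2 : v ^ (-m - 1 - 1) = v ^ (-m) / v / v := by rw [Real.rpow_sub_one hv.ne', e1]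
    simp only [Pi.sub_apply]
    rw [e2, e1]
    simp only [← hvdef]
    field_simp
    ring
  · have h0 : deriv θ t = 0 := by
      rw [(notMem_tsupport_iff_eventuallyEq.1 ht).deriv_eq]; simp
    rw [dphi_zero (Or.inr ht), h0]
    have : Wt N l m ε ψ u θ x =ᶠ[𝓝 t] fun _ => 0 := by
      filter_upwards [notMem_tsupport_iff_eventuallyEq.1 ht] with τ hτ
      simp [Wt, hτ]
    simpa using (hasDerivAt_const t (0:ℝ)).congr_of_eventuallyEq this
end dat


lemma int_prod_bdd {N : ℕ} {B : Set (E N)} {S : Set ℝ} (hB : MeasurableSet B) (hS : MeasurableSet S)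
    (hBf : volume B < ∞) (hSf : volume S < ∞) {F : E N × ℝ → ℝ} {C : ℝ}
    (hF : AEStronglyMeasurable F ((volume : Measure (E N × ℝ)).restrict (B ×ˢ S)))
    (hC : ∀ p ∈ B ×ˢ S, |F p| ≤ C) :
    Integrable F (((volume : Measure (E N)).restrict B).prod ((volume : Measure ℝ).restrict S)) := by
  rw [Measure.prod_restrict]
  have : IsFiniteMeasure (((volume : Measure (E N)).prod (volume : Measure ℝ)).restrict (B ×ˢ S)) :=
    ⟨by rw [Measure.restrict_apply_univ, Measure.prod_prod]; exact ENNReal.mul_lt_top hBf hSf⟩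
  refine Integrable.of_bound hF C ?_
  filter_upwards [ae_restrict_mem (hB.prod hS)] with p hp
  exact hC p hp

section dat
variable {N : ℕ} {s Λ a b M : ℝ} {x₀ : E N} {R r l m P Q d : ℝ} {ψ : E N → ℝ}
    {u : E N → ℝ → ℝ} {K : E N → E N → ℝ → ℝ} {θ : ℝ → ℝ}

/-- the `L^1` mass -/
def Yt (N : ℕ) (x₀ : E N) (r l m ε : ℝ) (ψ : E N → ℝ) (u : E N → ℝ → ℝ) (t : ℝ) : ℝ :=
  ∫ x in ball x₀ r, (u x t + l) ^ (-m) * Psi m ε (ψ x)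

lemma Y_integrand_bd (D : Dat N s Λ a b M x₀ R r l m P Q d ψ u K) {ε : ℝ} (hε : 0 ≤ ε) (hε1 : ε ≤ 1)
    {x : E N} {t : ℝ} (hx : x ∈ ball x₀ r) (ht : t ∈ Ioo a b) :
    0 ≤ (u x t + l) ^ (-m) * Psi m ε (ψ x) ∧
    (u x t + l) ^ (-m) * Psi m ε (ψ x) ≤ l ^ (-m) * (P + 1) ^ (m + 2) := by
  have h0 := D.u0 t ht x (ball_subset_ball D.hrR.le hx)
  have h1 := rpow_neg_le m l (u x t + l) D.hm.le D.hl (by linarith)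
  have h2 := Psi_le m ε (ψ x) P D.hm hε hε1 (D.ψok.nn x) (D.ψok.le x)
  have h3 := Psi_nonneg m ε (ψ x) D.hm hε (D.ψok.nn x)
  have hl := D.hl
  have : 0 ≤ l ^ (-m) := by positivity
  constructor
  · positivity
  · gcongr

lemma Y_meas (D : Dat N s Λ a b M x₀ R r l m P Q d ψ u K) {ε : ℝ} :
    Measurable (fun p : E N × ℝ => (u p.1 p.2 + l) ^ (-m) * Psi m ε (ψ p.1)) := by
  have := D.um
  have := D.ψs.continuous.measurable
  unfold Psi
  fun_prop

lemma Dat.ab (_ : Dat N s Λ a b M x₀ R r l m P Q d ψ u K) : volume (ball x₀ r) < ∞ := measure_ball_lt_top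

lemma time_fubini (D : Dat N s Λ a b M x₀ R r l m P Q d ψ u K) (hab : a < b) (hθ : Th a b θ) {ε : ℝ} (hε : 0 < ε) (hε1 : ε ≤ 1) :
    ∫ t in Ioo a b, ∫ x in ball x₀ r, u x t * dphi N l m ε ψ u θ x t =
      -(1 / m * ∫ t in Ioo a b, Yt N x₀ r l m ε ψ u t * deriv θ t) := by
  obtain ⟨C, hC⟩ := dphi_bdd D hθ hε
  have hθ'c : Continuous (deriv θ) := hθ.sm.continuous_deriv (by simp)
  obtain ⟨C', hC'⟩ := hθ.cs.deriv.exists_bound_of_continuous hθ'c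
  have hC0 : 0 ≤ C := (abs_nonneg _).trans (hC x₀ a)
  have hC0' : 0 ≤ C' := (norm_nonneg _).trans (hC' a)
  have hIf : volume (Ioo a b) < ∞ := by simp
  have m1 : Measurable (fun p : E N × ℝ => u p.1 p.2 * dphi N l m ε ψ u θ p.1 p.2) :=
    D.um.mul (dphi_cont D hθ hε).measurable
  have m2 : Measurable (fun p : E N × ℝ => (u p.1 p.2 + l) ^ (-m) * Psi m ε (ψ p.1) * deriv θ p.2) :=
    (Y_meas D).mul (hθ'c.measurable.comp measurable_snd)
  have b1 : ∀ t ∈ Ioo a b, ∀ x, |u x t * dphi N l m ε ψ u θ x t| ≤ M * C := by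
    intro t ht x
    rw [abs_mul]
    exact mul_le_mul (D.ub t ht x) (hC x t) (abs_nonneg _) ((abs_nonneg _).trans (D.ub t ht x))
  have b2 : ∀ t ∈ Ioo a b, ∀ x ∈ ball x₀ r, |(u x t + l) ^ (-m) * Psi m ε (ψ x) * deriv θ t| ≤ l ^ (-m) * (P + 1) ^ (m + 2) * C' := by
    intro t ht x hx
    obtain ⟨h1, h2⟩ := Y_integrand_bd D hε.le hε1 hx ht
    rw [abs_mul, abs_of_nonneg h1]
    exact mul_le_mul h2 (hC' t) (abs_nonneg _) (h1.trans h2)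
  have i1 : Integrable (fun p : E N × ℝ => u p.1 p.2 * dphi N l m ε ψ u θ p.1 p.2)
      (((volume : Measure (E N)).restrict (ball x₀ r)).prod ((volume : Measure ℝ).restrict (Ioo a b))) :=
    int_prod_bdd measurableSet_ball measurableSet_Ioo D.ab hIf m1.aestronglyMeasurable
      (fun p hp => b1 p.2 hp.2 p.1)
  have i2 : Integrable (fun p : E N × ℝ => (u p.1 p.2 + l) ^ (-m) * Psi m ε (ψ p.1) * deriv θ p.2)
      (((volume : Measure (E N)).restrict (ball x₀ r)).prod ((volume : Measure ℝ).restrict (Ioo a b))) :=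
    int_prod_bdd measurableSet_ball measurableSet_Ioo D.ab hIf m2.aestronglyMeasurable
      (fun p hp => b2 p.2 hp.2 p.1 hp.1)
  have key : ∀ x ∈ ball x₀ r, ∫ t in Ioo a b, u x t * dphi N l m ε ψ u θ x t =
      -(1 / m * ∫ t in Ioo a b, (u x t + l) ^ (-m) * Psi m ε (ψ x) * deriv θ t) := by
    intro x hx
    have j1 : IntegrableOn (fun t => u x t * dphi N l m ε ψ u θ x t) (Ioo a b) := by
      refine Measure.integrableOn_of_bounded (M := M * C) hIf.ne
        (m1.comp (by fun_prop : Measurable fun t : ℝ => (x, t))).aestronglyMeasurable ?_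
      filter_upwards [ae_restrict_mem measurableSet_Ioo] with t ht
      exact b1 t ht x
    have j2 : IntegrableOn (fun t => (u x t + l) ^ (-m) * Psi m ε (ψ x) * deriv θ t) (Ioo a b) := by
      refine Measure.integrableOn_of_bounded (M := l ^ (-m) * (P + 1) ^ (m + 2) * C') hIf.ne
        (m2.comp (by fun_prop : Measurable fun t : ℝ => (x, t))).aestronglyMeasurable ?_
      filter_upwards [ae_restrict_mem measurableSet_Ioo] with t ht
      exact b2 t ht x hx
    have j3 := intervalIntegral.integral_eq_sub_of_hasDerivAt (a := a) (b := b)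
      (fun t _ => Wt_deriv D hθ (ε := ε) (ball_subset_ball D.hrR.le hx) t)
      ((intervalIntegrable_iff_integrableOn_Ioo_of_le hab.le).2 (j1.add (j2.const_mul (1 / m))))
    have ha0 : θ a = 0 := image_eq_zero_of_notMem_tsupport fun h => (lt_irrefl a (hθ.ts h).1)
    have hb0 : θ b = 0 := image_eq_zero_of_notMem_tsupport fun h => (lt_irrefl b (hθ.ts h).2)
    have j4 : Wt N l m ε ψ u θ x b - Wt N l m ε ψ u θ x a = 0 := by simp [Wt, ha0, hb0]
    rw [j4, intervalIntegral.integral_of_le hab.le, integral_Ioc_eq_integral_Ioo,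
      integral_add j1 (j2.const_mul (1 / m)), integral_const_mul] at j3
    linarith
  have sw1 := integral_integral_swap (f := fun x t => u x t * dphi N l m ε ψ u θ x t) i1
  have sw2 := integral_integral_swap (f := fun x t => (u x t + l) ^ (-m) * Psi m ε (ψ x) * deriv θ t) i2
  rw [← sw1, setIntegral_congr_fun measurableSet_ball key, integral_neg, integral_const_mul, sw2]
  simp only [Yt, integral_mul_const]

end dat


section dat
variable {N : ℕ} {s Λ a b M : ℝ} {x₀ : E N} {R r l m P Q d : ℝ} {ψ : E N → ℝ}
    {u : E N → ℝ → ℝ} {K : E N → E N → ℝ → ℝ} {θ : ℝ → ℝ}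

def Gt (N : ℕ) (x₀ : E N) (r l m ε : ℝ) (ψ : E N → ℝ) (u : E N → ℝ → ℝ) (t : ℝ) : ℝ :=
  ∫ x in ball x₀ r, Gint N l m ε ψ (fun y => u y t) x

def Nt (N : ℕ) (l m ε : ℝ) (ψ : E N → ℝ) (u : E N → ℝ → ℝ) (K : E N → E N → ℝ → ℝ) (t : ℝ) : ℝ :=
  ∫ x, ∫ y, (u x t - u y t) * (fe N l m ε ψ (fun y => u y t) x - fe N l m ε ψ (fun y => u y t) y) * K x y t

lemma grad_phi_zero {ε : ℝ} {x : E N} {t : ℝ} (h : x ∉ tsupport ψ ∨ θ t = 0) :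
    gradient (fun y => phi N l m ε ψ u θ y t) x = 0 := by
  have : (fun y => phi N l m ε ψ u θ y t) =ᶠ[𝓝 x] fun _ => 0 := by
    rcases h with h | h
    · filter_upwards [notMem_tsupport_iff_eventuallyEq.1 h] with y hy
      exact phi_zero (Or.inl hy)
    · exact Filter.Eventually.of_forall fun y => phi_zero (Or.inr h)
  rw [gradient, this.fderiv_eq]
  simp

lemma weak_eps (D : Dat N s Λ a b M x₀ R r l m P Q d ψ u K) (hab : a < b) (hθ : Th a b θ)
    {T : ℝ} {Ω : Set (E N)} (hΩ : MeasurableSet Ω) (hsubx : ball x₀ R ⊆ Ω) (hsubt : Ioo a b ⊆ Ioo 0 T)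
    (hu : IsWeakSupersolution N T K Ω u) {ε : ℝ} (hε : 0 < ε) (hε1 : ε ≤ 1) :
    0 ≤ 1 / m * (∫ t in Ioo a b, Yt N x₀ r l m ε ψ u t * deriv θ t) +
      (∫ t in Ioo a b, Gt N x₀ r l m ε ψ u t * θ t) + ∫ t in Ioo a b, Nt N l m ε ψ u K t * θ t := by
  have hw := hu.2.2.2 (phi N l m ε ψ u θ) (phi_smooth D hθ hε) (phi_compact D hθ)
    ((phi_tsupport' D hθ).trans (prod_mono hsubx hsubt)) (phi_nonneg D hθ hε.le)
  have hBΩ : ball x₀ r ⊆ Ω := (ball_subset_ball D.hrR.le).trans hsubx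
  have hnt : ∀ t, t ∉ Ioo a b → t ∉ tsupport θ := fun t ht h => ht (hθ.ts h)
  have hnt' : ∀ t, t ∉ Ioo a b → θ t = 0 := fun t ht => image_eq_zero_of_notMem_tsupport (hnt t ht)
  have hnx : ∀ x, x ∉ ball x₀ r → x ∉ tsupport ψ := fun t ht h => ht (D.ψsupp h)
  -- restrict
  have e1 : ∫ t in Ioo 0 T, ∫ x in Ω, u x t * deriv (fun τ => phi N l m ε ψ u θ x τ) t =
      ∫ t in Ioo a b, ∫ x in ball x₀ r, u x t * dphi N l m ε ψ u θ x t := by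
    rw [setIntegral_eq_of_subset_of_forall_sdiff_eq_zero measurableSet_Ioo hsubt]
    · refine setIntegral_congr_fun measurableSet_Ioo fun t ht => ?_
      refine setIntegral_eq_of_subset_of_forall_sdiff_eq_zero hΩ hBΩ fun x hx => ?_
      have : deriv (fun τ => phi N l m ε ψ u θ x τ) t = 0 := dphi_zero (Or.inl (D.psi0 hx.2))
      rw [this, mul_zero]
    · intro t ht
      have : ∀ x, deriv (fun τ => phi N l m ε ψ u θ x τ) t = 0 := fun x => dphi_zero (Or.inr (hnt t ht.2))
      simp [this]
  have e2 : ∫ t in Ioo 0 T, ∫ x in Ω, ⟪gradient (fun y => u y t) x, gradient (fun y => phi N l m ε ψ u θ y t) x⟫ =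
      ∫ t in Ioo a b, Gt N x₀ r l m ε ψ u t * θ t := by
    rw [setIntegral_eq_of_subset_of_forall_sdiff_eq_zero measurableSet_Ioo hsubt]
    · refine setIntegral_congr_fun measurableSet_Ioo fun t ht => ?_
      simp only [Gt]
      rw [← integral_mul_const, setIntegral_eq_of_subset_of_forall_sdiff_eq_zero hΩ hBΩ]
      · refine setIntegral_congr_fun measurableSet_ball fun x hx => ?_
        have hx' := ball_subset_ball D.hrR.le hx
        exact Gint_eq D.hm (θ t) (u_fd D.us hx' ht).differentiableAt (D.ψs.contDiffAt.differentiableAt (by simp))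
          (D.vpos ht hx').ne'
      · intro x hx
        rw [grad_phi_zero (Or.inl (hnx x hx.2)), inner_zero_right]
    · intro t ht
      have : ∀ x, gradient (fun y => phi N l m ε ψ u θ y t) x = 0 := fun x => grad_phi_zero (Or.inr (hnt' t ht.2))
      simp [this]
  have e3 : ∫ t in Ioo 0 T, ∫ x : E N, ∫ y : E N,
          (u x t - u y t) * (phi N l m ε ψ u θ x t - phi N l m ε ψ u θ y t) * K x y t =
      ∫ t in Ioo a b, Nt N l m ε ψ u K t * θ t := by
    rw [setIntegral_eq_of_subset_of_forall_sdiff_eq_zero measurableSet_Ioo hsubt]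
    · refine setIntegral_congr_fun measurableSet_Ioo fun t ht => ?_
      simp only [Nt]
      rw [← integral_mul_const]
      congr 1; ext x
      rw [← integral_mul_const]
      congr 1; ext y
      unfold phi
      ring
    · intro t ht
      have : ∀ x, phi N l m ε ψ u θ x t = 0 := fun x => phi_zero (Or.inr (hnt' t ht.2))
      simp [this]
  rw [e1, e2, e3, time_fubini D hab hθ hε hε1, neg_neg] at hw
  exact hw

end dat


structure FamOK (a b : ℝ) (F : ℝ → ℝ → ℝ) : Prop where
  meas : ∀ ε ∈ Icc (0:ℝ) 1, AEStronglyMeasurable (F ε) (volume.restrict (Ioo a b))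
  bd : ∀ S : Set ℝ, IsCompact S → S ⊆ Ioo a b → ∃ C, ∀ t ∈ S, ∀ ε ∈ Icc (0:ℝ) 1, |F ε t| ≤ C
  lim : ∀ t ∈ Ioo a b, Filter.Tendsto (fun n : ℕ => F (1 / ((n:ℝ) + 1)) t) Filter.atTop (𝓝 (F 0 t))

lemma eps_mem (n : ℕ) : 1 / ((n:ℝ) + 1) ∈ Icc (0:ℝ) 1 :=
  ⟨by positivity, by rw [div_le_one (by positivity)]; linarith [(Nat.cast_nonneg n : (0:ℝ) ≤ n)]⟩

lemma FamOK.bound {a b : ℝ} {F : ℝ → ℝ → ℝ} (h : FamOK a b F) {g : ℝ → ℝ} (hg : Continuous g)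
    (hgc : HasCompactSupport g) (hgs : tsupport g ⊆ Ioo a b) :
    ∃ C, ∀ t, ∀ ε ∈ Icc (0:ℝ) 1, |F ε t * g t| ≤ C := by
  obtain ⟨C, hC⟩ := h.bd _ hgc.isCompact hgs
  obtain ⟨C', hC'⟩ := hgc.exists_bound_of_continuous hg
  have h0 : 0 ≤ C' := (norm_nonneg _).trans (hC' a)
  refine ⟨max C 0 * C', fun t ε hε => ?_⟩
  by_cases ht : t ∈ tsupport g
  · rw [abs_mul]
    exact mul_le_mul ((hC t ht ε hε).trans (le_max_left _ _)) (hC' t) (abs_nonneg _) (le_max_right _ _)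
  · rw [image_eq_zero_of_notMem_tsupport ht, mul_zero, abs_zero]
    positivity

lemma FamOK.int {a b : ℝ} {F : ℝ → ℝ → ℝ} (h : FamOK a b F) {g : ℝ → ℝ} (hg : Continuous g)
    (hgc : HasCompactSupport g) (hgs : tsupport g ⊆ Ioo a b) {ε : ℝ} (hε : ε ∈ Icc (0:ℝ) 1) :
    IntegrableOn (fun t => F ε t * g t) (Ioo a b) := by
  obtain ⟨C, hC⟩ := h.bound hg hgc hgs
  have : IsFiniteMeasure ((volume : Measure ℝ).restrict (Ioo a b)) := ⟨by simp⟩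
  exact Integrable.of_bound ((h.meas ε hε).mul hg.aestronglyMeasurable) C (ae_of_all _ fun t => hC t ε hε)

lemma FamOK.tendsto {a b : ℝ} {F : ℝ → ℝ → ℝ} (h : FamOK a b F) {g : ℝ → ℝ} (hg : Continuous g)
    (hgc : HasCompactSupport g) (hgs : tsupport g ⊆ Ioo a b) :
    Filter.Tendsto (fun n : ℕ => ∫ t in Ioo a b, F (1 / ((n:ℝ) + 1)) t * g t) Filter.atTop
      (𝓝 (∫ t in Ioo a b, F 0 t * g t)) := by
  obtain ⟨C, hC⟩ := h.bound hg hgc hgs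
  have : IsFiniteMeasure ((volume : Measure ℝ).restrict (Ioo a b)) := ⟨by simp⟩
  refine tendsto_integral_of_dominated_convergence (fun _ => C)
    (fun n => (h.meas _ (eps_mem n)).mul hg.aestronglyMeasurable) (integrable_const C)
    (fun n => ae_of_all _ fun t => hC t _ (eps_mem n)) ?_
  filter_upwards [ae_restrict_mem measurableSet_Ioo] with t ht
  exact (h.lim t ht).mul_const _

section par
variable {N : ℕ} {a b : ℝ} {x₀ : E N} {R r : ℝ} {f : E N → ℝ → ℝ → ℝ}

def CtsP (N : ℕ) (a b : ℝ) (x₀ : E N) (R : ℝ) (f : E N → ℝ → ℝ → ℝ) : Prop :=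
  ContinuousOn (fun p : E N × ℝ × ℝ => f p.1 p.2.1 p.2.2) (ball x₀ R ×ˢ Ioo a b ×ˢ Icc (0:ℝ) 1)

lemma CtsP.bd (hf : CtsP N a b x₀ R f) (hrR : r < R) {S : Set ℝ} (hS : IsCompact S) (hSs : S ⊆ Ioo a b) :
    ∃ C, 0 ≤ C ∧ ∀ x ∈ ball x₀ r, ∀ t ∈ S, ∀ ε ∈ Icc (0:ℝ) 1, |f x t ε| ≤ C := by
  obtain ⟨C, hC⟩ := ((isCompact_closedBall x₀ r).prod (hS.prod (isCompact_Icc (a := (0:ℝ)) (b := 1)))).exists_bound_of_continuousOn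
    (hf.mono (prod_mono (closedBall_subset_ball hrR) (prod_mono hSs Subset.rfl)))
  exact ⟨max C 0, le_max_right _ _, fun x hx t ht ε hε =>
    (hC (x, t, ε) ⟨ball_subset_closedBall hx, ht, hε⟩).trans (le_max_left _ _)⟩

lemma CtsP.contX (hf : CtsP N a b x₀ R f) (hrR : r < R) {t ε : ℝ} (ht : t ∈ Ioo a b) (hε : ε ∈ Icc (0:ℝ) 1) :
    ContinuousOn (fun x => f x t ε) (ball x₀ r) := by
  have : ContinuousOn (fun x : E N => (x, t, ε)) (ball x₀ r) := by fun_prop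
  exact ContinuousOn.comp (g := fun p : E N × ℝ × ℝ => f p.1 p.2.1 p.2.2) hf this
    fun x hx => ⟨ball_subset_ball hrR.le hx, ht, hε⟩

lemma CtsP.intX (hf : CtsP N a b x₀ R f) (hrR : r < R) {t ε : ℝ} (ht : t ∈ Ioo a b) (hε : ε ∈ Icc (0:ℝ) 1) :
    IntegrableOn (fun x => f x t ε) (ball x₀ r) := by
  obtain ⟨C, h0, hC⟩ := hf.bd hrR (isCompact_singleton (x := t)) (by simpa using ht)
  have : IsFiniteMeasure ((volume : Measure (E N)).restrict (ball x₀ r)) := ⟨by simpa using measure_ball_lt_top⟩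
  refine Integrable.of_bound ((hf.contX hrR ht hε).aestronglyMeasurable measurableSet_ball) C ?_
  filter_upwards [ae_restrict_mem measurableSet_ball] with x hx
  exact hC x hx t rfl ε hε

lemma CtsP.fam (hf : CtsP N a b x₀ R f) (hrR : r < R) : FamOK a b (fun ε t => ∫ x in ball x₀ r, f x t ε) where
  meas := by
    intro ε hε
    have h1 : ContinuousOn (fun p : ℝ × E N => f p.2 p.1 ε) (Ioo a b ×ˢ ball x₀ r) := by
      have : ContinuousOn (fun p : ℝ × E N => (p.2, p.1, ε)) (Ioo a b ×ˢ ball x₀ r) := by fun_prop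
      exact ContinuousOn.comp (g := fun p : E N × ℝ × ℝ => f p.1 p.2.1 p.2.2) hf this
        fun p hp => ⟨ball_subset_ball hrR.le hp.2, hp.1, hε⟩
    have h2 : AEStronglyMeasurable (fun p : ℝ × E N => f p.2 p.1 ε)
       (((volume : Measure ℝ).restrict (Ioo a b)).prod ((volume : Measure (E N)).restrict (ball x₀ r))) := by
      rw [Measure.prod_restrict]
      exact h1.aestronglyMeasurable (measurableSet_Ioo.prod measurableSet_ball)
    exact h2.integral_prod_right'
  bd := by
    intro S hS hSs
    obtain ⟨C, h0, hC⟩ := hf.bd hrR hS hSs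
    refine ⟨C * volume.real (ball x₀ r), fun t ht ε hε => ?_⟩
    rw [← Real.norm_eq_abs]
    exact norm_setIntegral_le_of_norm_le_const measure_ball_lt_top (fun x hx => hC x hx t ht ε hε)
  lim := by
    intro t ht
    obtain ⟨C, h0, hC⟩ := hf.bd hrR (isCompact_singleton (x := t)) (by simpa using ht)
    have : IsFiniteMeasure ((volume : Measure (E N)).restrict (ball x₀ r)) := ⟨by simpa using measure_ball_lt_top⟩
    refine tendsto_integral_of_dominated_convergence (fun _ => C)
      (fun n => (hf.intX hrR ht (eps_mem n)).aestronglyMeasurable) (integrable_const C) (fun n => ?_) ?_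
    · filter_upwards [ae_restrict_mem measurableSet_ball] with x hx
      exact hC x hx t rfl _ (eps_mem n)
    · filter_upwards [ae_restrict_mem measurableSet_ball] with x hx
      have h1 : ContinuousWithinAt (fun ε => f x t ε) (Icc 0 1) 0 := by
        have : ContinuousOn (fun ε : ℝ => (x, t, ε)) (Icc 0 1) := by fun_prop
        exact (ContinuousOn.comp (g := fun p : E N × ℝ × ℝ => f p.1 p.2.1 p.2.2) hf this
          fun ε hε => ⟨ball_subset_ball hrR.le hx, ht, hε⟩) 0 ⟨le_rfl, zero_le_one⟩
      refine h1.tendsto.comp (tendsto_nhdsWithin_iff.2 ⟨tendsto_one_div_add_atTop_nhds_zero_nat,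
        Filter.Eventually.of_forall eps_mem⟩)
end par

section dat
variable {N : ℕ} {s Λ a b M : ℝ} {x₀ : E N} {R r l m P Q d : ℝ} {ψ : E N → ℝ}
    {u : E N → ℝ → ℝ} {K : E N → E N → ℝ → ℝ} {θ : ℝ → ℝ}

abbrev U3 (N : ℕ) (a b : ℝ) (x₀ : E N) (R : ℝ) : Set (E N × ℝ × ℝ) := ball x₀ R ×ˢ Ioo a b ×ˢ Icc (0:ℝ) 1

lemma Dat.cV (D : Dat N s Λ a b M x₀ R r l m P Q d ψ u K) (q : ℝ) :
    ContinuousOn (fun p : E N × ℝ × ℝ => (u p.1 p.2.1 + l) ^ q) (U3 N a b x₀ R) := by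
  have h1 : ContinuousOn (fun p : E N × ℝ × ℝ => (p.1, p.2.1)) (U3 N a b x₀ R) := by fun_prop
  have h2 : ContinuousOn (fun p : E N × ℝ × ℝ => u p.1 p.2.1) (U3 N a b x₀ R) :=
    ContinuousOn.comp (g := fun p : E N × ℝ => u p.1 p.2) D.us.continuousOn h1 fun p hp => ⟨hp.1, hp.2.1⟩
  exact (h2.add continuousOn_const).rpow_const fun p hp => Or.inl (D.vpos hp.2.1 hp.1).ne'

lemma Dat.cGu (D : Dat N s Λ a b M x₀ R r l m P Q d ψ u K) :
    ContinuousOn (fun p : E N × ℝ × ℝ => gradient (fun y => u y p.2.1) p.1) (U3 N a b x₀ R) := by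
  have h1 : ContinuousOn (fun p : E N × ℝ × ℝ => (p.1, p.2.1)) (U3 N a b x₀ R) := by fun_prop
  exact ContinuousOn.comp (g := fun p : E N × ℝ => gradient (fun y => u y p.2) p.1) (u_grad_cont D.us) h1 fun p hp => ⟨hp.1, hp.2.1⟩

lemma Dat.gψ (D : Dat N s Λ a b M x₀ R r l m P Q d ψ u K) : Continuous (gradient ψ) := by
  unfold gradient
  exact (LinearIsometryEquiv.continuous _).comp (D.ψs.continuous_fderiv (by simp))

lemma Dat.cPψ (D : Dat N s Λ a b M x₀ R r l m P Q d ψ u K) {q : ℝ} (hq : 0 ≤ q) :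
    Continuous (fun p : E N × ℝ × ℝ => (ψ p.1 + p.2.2) ^ q) := by
  have := D.ψs.continuous
  exact Continuous.rpow_const (by fun_prop) fun _ => Or.inr hq

lemma Dat.cPψ0 (D : Dat N s Λ a b M x₀ R r l m P Q d ψ u K) {q : ℝ} (hq : 0 ≤ q) :
    Continuous (fun p : E N × ℝ × ℝ => (ψ p.1) ^ q) := by
  have := D.ψs.continuous
  exact Continuous.rpow_const (by fun_prop) fun _ => Or.inr hq

lemma Dat.cPsi (D : Dat N s Λ a b M x₀ R r l m P Q d ψ u K) :
    Continuous (fun p : E N × ℝ × ℝ => Psi m p.2.2 (ψ p.1)) := by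
  unfold Psi
  have hm := D.hm
  refine (D.cPψ (by linarith)).sub (Continuous.rpow_const (by fun_prop) fun _ => Or.inr (by linarith))

lemma Dat.ctsY (D : Dat N s Λ a b M x₀ R r l m P Q d ψ u K) :
    CtsP N a b x₀ R (fun x t ε => (u x t + l) ^ (-m) * Psi m ε (ψ x)) :=
  (D.cV _).mul D.cPsi.continuousOn

lemma Dat.ctsG (D : Dat N s Λ a b M x₀ R r l m P Q d ψ u K) :
    CtsP N a b x₀ R (fun x t ε => Gint N l m ε ψ (fun y => u y t) x) := by
  have hm := D.hm
  unfold Gint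
  refine ContinuousOn.add ?_ ?_
  · refine ContinuousOn.mul ((D.cV _).mul (continuousOn_const.mul (D.cPψ (by linarith)).continuousOn)) ?_
    exact D.cGu.inner (𝕜 := ℝ) (D.gψ.comp continuous_fst).continuousOn
  · exact (D.cPsi.continuousOn.mul (continuousOn_const.mul (D.cV _))).mul (D.cGu.norm.pow 2)

/-- the energy density -/
def Iint (N : ℕ) (l m : ℝ) (ψ : E N → ℝ) (u : E N → ℝ → ℝ) (x : E N) (t : ℝ) : ℝ :=
  ‖gradient (fun y => (u y t + l) ^ (-(m / 2))) x‖ ^ 2 * ψ x ^ (m + 2)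

lemma Dat.ctsI (D : Dat N s Λ a b M x₀ R r l m P Q d ψ u K) :
    CtsP N a b x₀ R (fun x t _ => Iint N l m ψ u x t) := by
  have hm := D.hm
  have : ContinuousOn (fun p : E N × ℝ × ℝ => ‖((-(m / 2)) * (u p.1 p.2.1 + l) ^ (-(m / 2) - 1)) •
      gradient (fun y => u y p.2.1) p.1‖ ^ 2 * ψ p.1 ^ (m + 2)) (U3 N a b x₀ R) := by
    refine ContinuousOn.mul ?_ (D.cPψ0 (by linarith)).continuousOn
    exact ((continuousOn_const.mul (D.cV _)).smul D.cGu).norm.pow 2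
  refine this.congr fun p hp => ?_
  simp only [Iint]
  rw [grad_rpow (u_fd D.us hp.1 hp.2.1).differentiableAt (D.vpos hp.2.1 hp.1).ne']

def Pint (N : ℕ) (l m : ℝ) (ψ : E N → ℝ) (u : E N → ℝ → ℝ) (x : E N) (t : ℝ) : ℝ :=
  ‖gradient ψ x‖ ^ 2 * (u x t + l) ^ (-m) * ψ x ^ m

lemma Dat.ctsP (D : Dat N s Λ a b M x₀ R r l m P Q d ψ u K) :
    CtsP N a b x₀ R (fun x t _ => Pint N l m ψ u x t) := by
  have hm := D.hm
  exact ((((D.gψ.comp continuous_fst).norm.pow 2).continuousOn).mul (D.cV _)).mul (D.cPψ0 (by linarith)).continuousOn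

lemma Dat.famN (D : Dat N s Λ a b M x₀ R r l m P Q d ψ u K) : FamOK a b (fun ε t => Nt N l m ε ψ u K t) := by
  have hψm := D.ψs.continuous.measurable
  have hmt : ∀ ε, Measurable (fun p : (ℝ × E N) × E N => (u p.1.2 p.1.1 - u p.2 p.1.1) *
      (fe N l m ε ψ (fun y => u y p.1.1) p.1.2 - fe N l m ε ψ (fun y => u y p.1.1) p.2) * K p.1.2 p.2 p.1.1) := by
    intro ε
    have h1 : Measurable (fun p : (ℝ × E N) × E N => u p.1.2 p.1.1) := D.um.comp (by fun_prop : Measurable fun p : (ℝ × E N) × E N => (p.1.2, p.1.1))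
    have h2 : Measurable (fun p : (ℝ × E N) × E N => u p.2 p.1.1) := D.um.comp (by fun_prop : Measurable fun p : (ℝ × E N) × E N => (p.2, p.1.1))
    have h3 : Measurable (fun p : (ℝ × E N) × E N => K p.1.2 p.2 p.1.1) := D.Km.comp (by fun_prop : Measurable fun p : (ℝ × E N) × E N => (p.1.2, p.2, p.1.1))
    unfold fe Psi
    have h4 : Measurable (fun p : (ℝ × E N) × E N => (ψ p.1.2 + ε) ^ (m + 2) - ε ^ (m + 2)) := by fun_prop
    have h5 : Measurable (fun p : (ℝ × E N) × E N => (ψ p.2 + ε) ^ (m + 2) - ε ^ (m + 2)) := by fun_prop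
    exact ((h1.sub h2).mul ((((h1.add_const l).pow_const _).mul h4).sub (((h2.add_const l).pow_const _).mul h5))).mul h3
  have hint : ∀ t ∈ Ioo a b, ∀ ε, Measurable (fun p : E N × E N => (u p.1 t - u p.2 t) *
      (fe N l m ε ψ (fun y => u y t) p.1 - fe N l m ε ψ (fun y => u y t) p.2) * K p.1 p.2 t) := by
    intro t ht ε
    exact (hmt ε).comp (by fun_prop : Measurable fun p : E N × E N => ((t, p.1), p.2))
  have hbd : ∀ S : Set ℝ, IsCompact S → S ⊆ Ioo a b → ∃ C, ∀ t ∈ S, ∀ ε ∈ Icc (0:ℝ) 1, ∀ x y,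
      |(u x t - u y t) * (fe N l m ε ψ (fun y => u y t) x - fe N l m ε ψ (fun y => u y t) y) * K x y t| ≤
       C * domF N s (ball x₀ r) (x, y) := by
    intro S hS hSs
    obtain ⟨L, hL0, -, hL⟩ := u_lip D.us D.hrR hS hSs
    obtain ⟨C, hC0, hC⟩ := dom_bound N s Λ D.hΛ x₀ r M P Q d l m L ψ D.hr D.hr1 D.ψok D.hl D.hm hL0
    exact ⟨C, fun t ht ε hε x y => hC (fun y => u y t) (fun x y => K x y t) ε (D.sp (hSs ht)) hε.1 hε.2 (hL t ht) x y⟩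
  have heq : ∀ t ∈ Ioo a b, ∀ ε ∈ Icc (0:ℝ) 1, Nt N l m ε ψ u K t = ∫ p : E N × E N, (u p.1 t - u p.2 t) *
      (fe N l m ε ψ (fun y => u y t) p.1 - fe N l m ε ψ (fun y => u y t) p.2) * K p.1 p.2 t ∂(volume.prod volume) := by
    intro t ht ε hε
    obtain ⟨C, hC⟩ := hbd {t} isCompact_singleton (by simpa using ht)
    have hi := int_of_dom N D.hN s D.hs x₀ r C _ (hint t ht ε) (fun p => hC t rfl ε hε p.1 p.2)
    exact integral_integral (f := fun x y => (u x t - u y t) *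
      (fe N l m ε ψ (fun y => u y t) x - fe N l m ε ψ (fun y => u y t) y) * K x y t) hi
  refine ⟨?_, ?_, ?_⟩
  · intro ε hε
    have h1 := (hmt ε).stronglyMeasurable.integral_prod_right' (ν := (volume : Measure (E N)))
    have h2 := h1.integral_prod_right' (ν := (volume : Measure (E N)))
    exact h2.aestronglyMeasurable
  · intro S hS hSs
    obtain ⟨C, hC⟩ := hbd S hS hSs
    refine ⟨∫ p, C * domF N s (ball x₀ r) p ∂(volume.prod volume), fun t ht ε hε => ?_⟩
    rw [heq t (hSs ht) ε hε, ← Real.norm_eq_abs]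
    exact norm_integral_le_of_norm_le ((domF_integrable N D.hN s D.hs x₀ r).const_mul C)
      (ae_of_all _ fun p => hC t ht ε hε p.1 p.2)
  · intro t ht
    obtain ⟨C, hC⟩ := hbd {t} isCompact_singleton (by simpa using ht)
    rw [heq t ht 0 ⟨le_rfl, zero_le_one⟩]
    simp_rw [fun n : ℕ => heq t ht _ (eps_mem n)]
    refine tendsto_integral_of_dominated_convergence (fun p => C * domF N s (ball x₀ r) p)
      (fun n => (hint t ht _).aestronglyMeasurable) ((domF_integrable N D.hN s D.hs x₀ r).const_mul C)
      (fun n => ae_of_all _ fun p => hC t rfl _ (eps_mem n) p.1 p.2) (ae_of_all _ fun p => ?_)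
    have hfe : ∀ x, Filter.Tendsto (fun n : ℕ => fe N l m (1 / ((n:ℝ) + 1)) ψ (fun y => u y t) x) Filter.atTop
        (𝓝 (fe N l m 0 ψ (fun y => u y t) x)) := by
      intro x
      have hc : Continuous (fun ε => fe N l m ε ψ (fun y => u y t) x) := by
        have hm := D.hm
        unfold fe Psi
        refine continuous_const.mul (Continuous.sub ?_ ?_)
        · exact Continuous.rpow_const (by fun_prop) fun _ => Or.inr (by linarith)
        · exact Continuous.rpow_const (by fun_prop) fun _ => Or.inr (by linarith)
      exact (hc.tendsto 0).comp tendsto_one_div_add_atTop_nhds_zero_nat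
    exact (((hfe p.1).sub (hfe p.2)).const_mul _).mul_const _

lemma weak_zero (D : Dat N s Λ a b M x₀ R r l m P Q d ψ u K) (hab : a < b) (hθ : Th a b θ)
    {T : ℝ} {Ω : Set (E N)} (hΩ : MeasurableSet Ω) (hsubx : ball x₀ R ⊆ Ω) (hsubt : Ioo a b ⊆ Ioo 0 T)
    (hu : IsWeakSupersolution N T K Ω u) :
    0 ≤ 1 / m * (∫ t in Ioo a b, Yt N x₀ r l m 0 ψ u t * deriv θ t) +
      (∫ t in Ioo a b, Gt N x₀ r l m 0 ψ u t * θ t) + ∫ t in Ioo a b, Nt N l m 0 ψ u K t * θ t := by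
  have hθ'c : Continuous (deriv θ) := hθ.sm.continuous_deriv (by simp)
  have hθc := hθ.sm.continuous
  have t1 := (D.ctsY.fam D.hrR).tendsto hθ'c hθ.cs.deriv ((tsupport_deriv_subset).trans hθ.ts)
  have t2 := (D.ctsG.fam D.hrR).tendsto hθc hθ.cs hθ.ts
  have t3 := D.famN.tendsto hθc hθ.cs hθ.ts
  refine ge_of_tendsto' (((t1.const_mul (1 / m)).add t2).add t3) fun n => ?_
  exact weak_eps D hab hθ hΩ hsubx hsubt hu (by positivity) (eps_mem n).2
end dat


section dat
variable {N : ℕ} {s Λ a b M : ℝ} {x₀ : E N} {R r l m P Q d : ℝ} {ψ : E N → ℝ}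
    {u : E N → ℝ → ℝ} {K : E N → E N → ℝ → ℝ} {θ : ℝ → ℝ}

def It (N : ℕ) (x₀ : E N) (r l m : ℝ) (ψ : E N → ℝ) (u : E N → ℝ → ℝ) (t : ℝ) : ℝ :=
  ∫ x in ball x₀ r, Iint N l m ψ u x t

def Pt (N : ℕ) (x₀ : E N) (r l m : ℝ) (ψ : E N → ℝ) (u : E N → ℝ → ℝ) (t : ℝ) : ℝ :=
  ∫ x in ball x₀ r, Pint N l m ψ u x t

def Y0 (N : ℕ) (x₀ : E N) (r l m : ℝ) (ψ : E N → ℝ) (u : E N → ℝ → ℝ) (t : ℝ) : ℝ :=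
  ∫ x in ball x₀ r, (u x t + l) ^ (-m) * ψ x ^ (m + 2)

def Jt (N : ℕ) (x₀ : E N) (r l m : ℝ) (ψ : E N → ℝ) (u : E N → ℝ → ℝ) (K : E N → E N → ℝ → ℝ) (t : ℝ) : ℝ :=
  ∫ x in ball x₀ r, ∫ y in ball x₀ r, Jint N l m ψ (fun y => u y t) (fun x y => K x y t) x y

lemma Y0_eq (hm : 0 < m) : Yt N x₀ r l m 0 ψ u = Y0 N x₀ r l m ψ u := by
  ext t
  simp only [Yt, Y0, Psi_zero' _ _ hm]

lemma zmem : (0:ℝ) ∈ Icc (0:ℝ) 1 := ⟨le_rfl, zero_le_one⟩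

lemma Dat.Y_ok (D : Dat N s Λ a b M x₀ R r l m P Q d ψ u K) :
    AEStronglyMeasurable (Y0 N x₀ r l m ψ u) (volume.restrict (Ioo a b)) ∧
    ∃ C, ∀ t ∈ Ioo a b, 0 ≤ Y0 N x₀ r l m ψ u t ∧ Y0 N x₀ r l m ψ u t ≤ C := by
  rw [← Y0_eq D.hm]
  refine ⟨(D.ctsY.fam D.hrR).meas 0 zmem, l ^ (-m) * (P + 1) ^ (m + 2) * volume.real (ball x₀ r), fun t ht => ⟨?_, ?_⟩⟩
  · exact setIntegral_nonneg measurableSet_ball fun x hx => (Y_integrand_bd D le_rfl zero_le_one hx ht).1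
  · refine (le_abs_self _).trans ?_
    rw [← Real.norm_eq_abs]
    refine norm_setIntegral_le_of_norm_le_const measure_ball_lt_top (fun x hx => ?_)
    have := (Y_integrand_bd D le_rfl zero_le_one hx ht)
    rw [Real.norm_eq_abs, abs_of_nonneg this.1]
    exact this.2

lemma Dat.J_ok (D : Dat N s Λ a b M x₀ R r l m P Q d ψ u K) :
    AEStronglyMeasurable (Jt N x₀ r l m ψ u K) (volume.restrict (Ioo a b)) ∧
    ∃ C, ∀ t ∈ Ioo a b, 0 ≤ Jt N x₀ r l m ψ u K t ∧ Jt N x₀ r l m ψ u K t ≤ C := by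
  have hψm := D.ψs.continuous.measurable
  have hmt : Measurable (fun p : (ℝ × E N) × E N =>
      Jint N l m ψ (fun y => u y p.1.1) (fun x y => K x y p.1.1) p.1.2 p.2) := by
    have h1 : Measurable (fun p : (ℝ × E N) × E N => u p.1.2 p.1.1) := D.um.comp (by fun_prop : Measurable fun p : (ℝ × E N) × E N => (p.1.2, p.1.1))
    have h2 : Measurable (fun p : (ℝ × E N) × E N => u p.2 p.1.1) := D.um.comp (by fun_prop : Measurable fun p : (ℝ × E N) × E N => (p.2, p.1.1))
    have h3 : Measurable (fun p : (ℝ × E N) × E N => K p.1.2 p.2 p.1.1) := D.Km.comp (by fun_prop : Measurable fun p : (ℝ × E N) × E N => (p.1.2, p.2, p.1.1))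
    have h4 : Measurable (fun p : (ℝ × E N) × E N => ψ p.1.2) := by fun_prop
    have h5 : Measurable (fun p : (ℝ × E N) × E N => ψ p.2) := by fun_prop
    unfold Jint
    exact (((h4.sub h5).pow_const 2).mul (((h4.pow_const _).mul ((h1.add_const l).pow_const _)).add ((h5.pow_const _).mul ((h2.add_const l).pow_const _)))).mul h3
  constructor
  · have h1 := hmt.stronglyMeasurable.integral_prod_right' (ν := (volume : Measure (E N)).restrict (ball x₀ r))
    have h2 := h1.integral_prod_right' (ν := (volume : Measure (E N)).restrict (ball x₀ r))
    exact h2.aestronglyMeasurable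
  · set c := (Q ^ 2 * (2 * (P ^ m * l ^ (-m))) * Λ * 4) with hc
    refine ⟨∫ p in ball x₀ r ×ˢ ball x₀ r, c * domF N s (ball x₀ r) p ∂(volume.prod volume), fun t ht => ?_⟩
    have hJ := fun x hx y hy => Jint_bound (x₀ := x₀) D.hΛ D.hr D.hr1 (D.sp ht) D.ψok D.hl D.hm x y hx hy
    refine ⟨setIntegral_nonneg measurableSet_ball fun x hx => setIntegral_nonneg measurableSet_ball fun y hy => (hJ x hx y hy).1, ?_⟩
    have hm1 : Measurable (fun p : E N × E N => Jint N l m ψ (fun y => u y t) (fun x y => K x y t) p.1 p.2) :=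
      hmt.comp (by fun_prop : Measurable fun p : E N × E N => ((t, p.1), p.2))
    have hd : IntegrableOn (fun p => c * domF N s (ball x₀ r) p) (ball x₀ r ×ˢ ball x₀ r) (volume.prod volume) :=
      ((domF_integrable N D.hN s D.hs x₀ r).const_mul c).integrableOn
    have hi : IntegrableOn (fun p : E N × E N => Jint N l m ψ (fun y => u y t) (fun x y => K x y t) p.1 p.2)
        (ball x₀ r ×ˢ ball x₀ r) (volume.prod volume) := by
      refine Integrable.mono' hd hm1.aestronglyMeasurable ?_
      filter_upwards [ae_restrict_mem (measurableSet_ball.prod measurableSet_ball)] with p hp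
      have := hJ p.1 hp.1 p.2 hp.2
      rw [Real.norm_eq_abs, abs_of_nonneg this.1]
      exact this.2
    have he : Jt N x₀ r l m ψ u K t = ∫ p in ball x₀ r ×ˢ ball x₀ r,
       Jint N l m ψ (fun y => u y t) (fun x y => K x y t) p.1 p.2 ∂(volume.prod volume) := by
      rw [setIntegral_prod _ hi]; rfl
    rw [he]
    exact setIntegral_mono_on hi hd (measurableSet_ball.prod measurableSet_ball) fun p hp => (hJ p.1 hp.1 p.2 hp.2).2

lemma Dat.P_ok (D : Dat N s Λ a b M x₀ R r l m P Q d ψ u K) :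
    AEStronglyMeasurable (Pt N x₀ r l m ψ u) (volume.restrict (Ioo a b)) ∧
    ∃ C, ∀ t ∈ Ioo a b, 0 ≤ Pt N x₀ r l m ψ u t ∧ Pt N x₀ r l m ψ u t ≤ C := by
  have hm := D.hm
  have hl := D.hl
  obtain ⟨Cg, hCg⟩ := (isCompact_closedBall x₀ r).exists_bound_of_continuousOn D.gψ.continuousOn
  have hb : ∀ t ∈ Ioo a b, ∀ x ∈ ball x₀ r, 0 ≤ Pint N l m ψ u x t ∧ Pint N l m ψ u x t ≤ Cg ^ 2 * l ^ (-m) * P ^ m := by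
    intro t ht x hx
    have h0 := D.u0 t ht x (ball_subset_ball D.hrR.le hx)
    have h1 := rpow_neg_le m l (u x t + l) D.hm.le D.hl (by linarith)
    have h2 := D.ψok.nn x
    have h3 := hCg x (ball_subset_closedBall hx)
    have h4 := D.ψok.le x
    have : 0 ≤ l ^ (-m) := by positivity
    unfold Pint
    constructor
    · positivity
    · gcongr
  refine ⟨(D.ctsP.fam D.hrR).meas 0 zmem, Cg ^ 2 * l ^ (-m) * P ^ m * volume.real (ball x₀ r), fun t ht => ⟨?_, ?_⟩⟩
  · exact setIntegral_nonneg measurableSet_ball fun x hx => (hb t ht x hx).1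
  · refine (le_abs_self _).trans ?_
    rw [← Real.norm_eq_abs]
    refine norm_setIntegral_le_of_norm_le_const measure_ball_lt_top (fun x hx => ?_)
    have := hb t ht x hx
    rw [Real.norm_eq_abs, abs_of_nonneg this.1]
    exact this.2

lemma bdd_int {a b C : ℝ} {F g : ℝ → ℝ} (hF : AEStronglyMeasurable F (volume.restrict (Ioo a b)))
    (hC : ∀ t ∈ Ioo a b, 0 ≤ F t ∧ F t ≤ C) (hg : Continuous g) :
    IntegrableOn (fun t => F t * g t) (Ioo a b) := by
  obtain ⟨C', hC'⟩ := (isCompact_Icc (a := a) (b := b)).exists_bound_of_continuousOn hg.continuousOn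
  have : IsFiniteMeasure ((volume : Measure ℝ).restrict (Ioo a b)) := ⟨by simp⟩
  refine Integrable.of_bound (hF.mul hg.aestronglyMeasurable) (C * C') ?_
  filter_upwards [ae_restrict_mem measurableSet_Ioo] with t ht
  rw [norm_mul, Real.norm_eq_abs, abs_of_nonneg (hC t ht).1]
  exact mul_le_mul (hC t ht).2 (hC' t (Ioo_subset_Icc_self ht)) (norm_nonneg _) ((hC t ht).1.trans (hC t ht).2)

lemma int_add3 {μ : Measure ℝ} {f g h : ℝ → ℝ} (hf : Integrable f μ) (hg : Integrable g μ) (hh : Integrable h μ) :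
    ∫ t, (f t + g t + h t) ∂μ = ∫ t, f t ∂μ + ∫ t, g t ∂μ + ∫ t, h t ∂μ := by
  rw [← integral_add hf hg]
  exact integral_add (hf.add hg) hh

lemma per_theta (D : Dat N s Λ a b M x₀ R r l m P Q d ψ u K) (hab : a < b) (hθ : Th a b θ)
    {T : ℝ} {Ω : Set (E N)} (hΩ : MeasurableSet Ω) (hsubx : ball x₀ R ⊆ Ω) (hsubt : Ioo a b ⊆ Ioo 0 T)
    (hu : IsWeakSupersolution N T K Ω u) {S1 S2 : ℝ}
    (hS1 : ∀ x ∈ tsupport ψ, ∫ y in (ball x₀ r)ᶜ, ‖x - y‖ ^ (-((N : ℝ) + 2 * s)) ≤ S1)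
    (hS2 : ∀ᵐ t ∂(volume.restrict (Ioo a b)), ∀ x ∈ tsupport ψ,
      ∫ y in (ball x₀ R)ᶜ, max (-u y t) 0 * ‖x - y‖ ^ (-((N : ℝ) + 2 * s)) ≤ S2) :
    2 * (m + 1) / m ^ 2 * (∫ t in Ioo a b, It N x₀ r l m ψ u t * θ t) ≤
      1 / m * (∫ t in Ioo a b, Y0 N x₀ r l m ψ u t * deriv θ t) +
      2 * max 4 ((6 * m + 1) / 2) * (∫ t in Ioo a b, Jt N x₀ r l m ψ u K t * θ t) +
      2 * Λ * (S1 + S2 / l) * (∫ t in Ioo a b, Y0 N x₀ r l m ψ u t * θ t) +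
      (m + 2) ^ 2 / (2 * (m + 1)) * (∫ t in Ioo a b, Pt N x₀ r l m ψ u t * θ t) := by
  have hw := weak_zero D hab hθ hΩ hsubx hsubt hu
  rw [Y0_eq D.hm] at hw
  have hθc := hθ.sm.continuous
  obtain ⟨mY, CY, hY⟩ := D.Y_ok
  obtain ⟨mJ, CJ, hJ⟩ := D.J_ok
  obtain ⟨mP, CP, hP⟩ := D.P_ok
  have iY := bdd_int mY hY hθc
  have iJ := bdd_int mJ hJ hθc
  have iP := bdd_int mP hP hθc
  have iI : IntegrableOn (fun t => It N x₀ r l m ψ u t * θ t) (Ioo a b) :=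
    (D.ctsI.fam D.hrR).int hθc hθ.cs hθ.ts zmem
  have iG : IntegrableOn (fun t => Gt N x₀ r l m 0 ψ u t * θ t) (Ioo a b) :=
    (D.ctsG.fam D.hrR).int hθc hθ.cs hθ.ts zmem
  have iN : IntegrableOn (fun t => Nt N l m 0 ψ u K t * θ t) (Ioo a b) :=
    D.famN.int hθc hθ.cs hθ.ts zmem
  have hG : ∀ t ∈ Ioo a b, 2 * (m + 1) / m ^ 2 * It N x₀ r l m ψ u t + Gt N x₀ r l m 0 ψ u t ≤
      (m + 2) ^ 2 / (2 * (m + 1)) * Pt N x₀ r l m ψ u t := by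
    intro t ht
    have j1 := D.ctsI.intX D.hrR ht zmem
    have j2 := D.ctsG.intX D.hrR ht zmem
    have j3 := D.ctsP.intX D.hrR ht zmem
    unfold It Gt Pt
    rw [← integral_const_mul, ← integral_const_mul, ← integral_add (j1.const_mul _) j2]
    refine setIntegral_mono_on ((j1.const_mul _).add j2) (j3.const_mul _) measurableSet_ball fun x hx => ?_
    have hx' := ball_subset_ball D.hrR.le hx
    exact Gint_ineq D.hm (w := fun y => u y t) (u_fd D.us hx' ht).differentiableAt (D.vpos ht hx') (D.ψok.nn x)
  have hN : ∀ᵐ t ∂(volume.restrict (Ioo a b)), Nt N l m 0 ψ u K t ≤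
      2 * max 4 ((6 * m + 1) / 2) * Jt N x₀ r l m ψ u K t + 2 * Λ * (S1 + S2 / l) * Y0 N x₀ r l m ψ u t := by
    filter_upwards [hS2, ae_restrict_mem measurableSet_Ioo] with t h2 ht
    obtain ⟨L, hL0, -, hL⟩ := u_lip D.us D.hrR (isCompact_singleton (x := t)) (by simpa using ht)
    exact nonlocal_ineq D.hN D.hs D.hΛ D.hr D.hr1 D.hrR (D.sp ht) D.ψok D.hl D.hm hL0 (hL t rfl) (D.u0 t ht) hS1 h2
  have hsum : ∫ t in Ioo a b, (2 * (m + 1) / m ^ 2 * (It N x₀ r l m ψ u t * θ t) + Gt N x₀ r l m 0 ψ u t * θ t + Nt N l m 0 ψ u K t * θ t) ≤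
     ∫ t in Ioo a b, ((m + 2) ^ 2 / (2 * (m + 1)) * (Pt N x₀ r l m ψ u t * θ t) +
        2 * max 4 ((6 * m + 1) / 2) * (Jt N x₀ r l m ψ u K t * θ t) + 2 * Λ * (S1 + S2 / l) * (Y0 N x₀ r l m ψ u t * θ t)) := by
    refine integral_mono_ae (((iI.const_mul _).add iG).add iN) (((iP.const_mul _).add (iJ.const_mul _)).add (iY.const_mul _)) ?_
    filter_upwards [hN, ae_restrict_mem measurableSet_Ioo] with t h1 ht
    have h2 := hG t ht
    have h3 := mul_le_mul_of_nonneg_right (add_le_add h2 h1) (hθ.nn t)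
    linarith
  rw [int_add3 (iI.const_mul _) iG iN, int_add3 (iP.const_mul _) (iJ.const_mul _) (iY.const_mul _),
    integral_const_mul, integral_const_mul, integral_const_mul, integral_const_mul] at hsum
  linarith
end dat


abbrev sT := Real.smoothTransition

lemma sT_cd : ContDiff ℝ (⊤ : ℕ∞) sT := Real.smoothTransition.contDiff

lemma sT_hd (z : ℝ) : HasDerivAt sT (deriv sT z) z :=
  (sT_cd.contDiffAt.differentiableAt (by simp)).hasDerivAt

lemma sT_d0 {z : ℝ} (hz : z < 0 ∨ 1 < z) : deriv sT z = 0 := by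
  rcases hz with hz | hz
  · have : sT =ᶠ[𝓝 z] fun _ => 0 := by
      filter_upwards [Iio_mem_nhds hz] with y hy
      exact Real.smoothTransition.zero_of_nonpos (le_of_lt hy)
    rw [this.deriv_eq]; simp
  · have : sT =ᶠ[𝓝 z] fun _ => 1 := by
      filter_upwards [Ioi_mem_nhds hz] with y hy
      exact Real.smoothTransition.one_of_one_le (le_of_lt hy)
    rw [this.deriv_eq]; simp

lemma sT_bd : ∃ C, 0 ≤ C ∧ ∀ z, 0 ≤ deriv sT z ∧ deriv sT z ≤ C := by
  have hc : Continuous (deriv sT) := sT_cd.continuous_deriv (by simp)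
  obtain ⟨C, hC⟩ := (isCompact_Icc (a := (0:ℝ)) (b := 1)).exists_bound_of_continuousOn hc.continuousOn
  refine ⟨max C 0, le_max_right _ _, fun z => ⟨?_, ?_⟩⟩
  · exact Real.smoothTransition.monotone.deriv_nonneg
  · by_cases h : z ∈ Icc (0:ℝ) 1
    · exact (le_abs_self _).trans ((hC z h).trans (le_max_left _ _))
    · rw [sT_d0]
      · exact le_max_right _ _
      · by_contra! h'
        exact h h'

def chi (a b : ℝ) (k : ℕ) (t : ℝ) : ℝ := sT (((k:ℝ) + 1) * (t - a) - 1) * sT (((k:ℝ) + 1) * (b - t) - 1)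

def ee (a : ℝ) (η : ℝ → ℝ) (k : ℕ) (t : ℝ) : ℝ := η t * (deriv sT (((k:ℝ) + 1) * (t - a) - 1) * ((k:ℝ) + 1))

section chi
variable {a b : ℝ} {k : ℕ} {η : ℝ → ℝ}
lemma chi_nn (t : ℝ) : 0 ≤ chi a b k t := mul_nonneg (Real.smoothTransition.nonneg _) (Real.smoothTransition.nonneg _)
lemma chi_le (t : ℝ) : chi a b k t ≤ 1 :=
  mul_le_one₀ (Real.smoothTransition.le_one _) (Real.smoothTransition.nonneg _) (Real.smoothTransition.le_one _)

lemma chi_th (hη : ContDiff ℝ (⊤ : ℕ∞) η) (hη0 : ∀ t, 0 ≤ η t) : Th a b (fun t => η t * chi a b k t) := by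
  have hsub : tsupport (fun t => η t * chi a b k t) ⊆ Icc (a + 1 / ((k:ℝ) + 1)) (b - 1 / ((k:ℝ) + 1)) := by
    refine closure_minimal (fun t ht => ?_) isClosed_Icc
    rw [Function.mem_support] at ht
    have hk : (0:ℝ) < (k:ℝ) + 1 := by positivity
    constructor
    · by_contra! h
      apply ht
      have : ((k:ℝ) + 1) * (t - a) - 1 ≤ 0 := by
        have : ((k:ℝ) + 1) * (t - a) ≤ ((k:ℝ) + 1) * (1 / ((k:ℝ) + 1)) := by gcongr; linarith
        rw [mul_one_div_cancel hk.ne'] at this; linarith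
      simp [chi, Real.smoothTransition.zero_of_nonpos this]
    · by_contra! h
      apply ht
      have : ((k:ℝ) + 1) * (b - t) - 1 ≤ 0 := by
        have : ((k:ℝ) + 1) * (b - t) ≤ ((k:ℝ) + 1) * (1 / ((k:ℝ) + 1)) := by gcongr; linarith
        rw [mul_one_div_cancel hk.ne'] at this; linarith
      simp [chi, Real.smoothTransition.zero_of_nonpos this]
  have hk : (0:ℝ) < 1 / ((k:ℝ) + 1) := by positivity
  refine ⟨?_, fun t => mul_nonneg (hη0 t) (chi_nn t),
    IsCompact.of_isClosed_subset isCompact_Icc (isClosed_tsupport _) hsub,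
    hsub.trans fun t ht => ⟨by linarith [ht.1], by linarith [ht.2]⟩⟩
  refine hη.mul (ContDiff.mul ?_ ?_)
  · exact sT_cd.comp (by fun_prop)
  · exact sT_cd.comp (by fun_prop)

lemma chi_deriv (hη : ContDiff ℝ (⊤ : ℕ∞) η) (hη0 : ∀ t, 0 ≤ η t) (t : ℝ) :
    deriv (fun t => η t * chi a b k t) t ≤ |deriv η t| + ee a η k t := by
  have h0 := (hη.contDiffAt.differentiableAt (x := t) (by simp)).hasDerivAt
  have e1 : HasDerivAt (fun t => ((k:ℝ) + 1) * (t - a) - 1) ((k:ℝ) + 1) t := by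
    simpa using (((hasDerivAt_id t).sub_const a).const_mul ((k:ℝ) + 1)).sub_const 1
  have e2 : HasDerivAt (fun t => ((k:ℝ) + 1) * (b - t) - 1) (-((k:ℝ) + 1)) t := by
    simpa using (((hasDerivAt_id t).const_sub b).const_mul ((k:ℝ) + 1)).sub_const 1
  have h1 : HasDerivAt (fun t => sT (((k:ℝ) + 1) * (t - a) - 1)) _ t := (sT_hd _).comp t e1
  have h2 : HasDerivAt (fun t => sT (((k:ℝ) + 1) * (b - t) - 1)) _ t := (sT_hd _).comp t e2
  have h3 : HasDerivAt (fun t => η t * chi a b k t) _ t := h0.mul (h1.mul h2)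
  rw [h3.deriv]
  obtain ⟨C, -, hC⟩ := sT_bd
  have c1 := (hC (((k:ℝ) + 1) * (t - a) - 1)).1
  have c2 := (hC (((k:ℝ) + 1) * (b - t) - 1)).1
  have c3 := Real.smoothTransition.nonneg (((k:ℝ) + 1) * (t - a) - 1)
  have c4 := Real.smoothTransition.le_one (((k:ℝ) + 1) * (b - t) - 1)
  have c5 := chi_nn (a := a) (b := b) (k := k) t
  have c6 := chi_le (a := a) (b := b) (k := k) t
  have hk : (0:ℝ) < (k:ℝ) + 1 := by positivity
  have hc : deriv η t * chi a b k t ≤ |deriv η t| := by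
    calc deriv η t * chi a b k t ≤ |deriv η t| * chi a b k t := by gcongr; exact le_abs_self _
      _ ≤ |deriv η t| * 1 := by gcongr
      _ = _ := mul_one _
  refine add_le_add hc ?_
  unfold ee
  refine mul_le_mul_of_nonneg_left ?_ (hη0 t)
  have c7 : deriv sT (((k:ℝ) + 1) * (t - a) - 1) * ((k:ℝ) + 1) * sT (((k:ℝ) + 1) * (b - t) - 1) ≤
    deriv sT (((k:ℝ) + 1) * (t - a) - 1) * ((k:ℝ) + 1) := mul_le_of_le_one_right (by positivity) c4
  have c8 : 0 ≤ sT (((k:ℝ) + 1) * (t - a) - 1) * (deriv sT (((k:ℝ) + 1) * (b - t) - 1) * ((k:ℝ) + 1)) := by positivity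
  linarith

lemma chi_lim {t : ℝ} (ht : t ∈ Ioo a b) : Filter.Tendsto (fun k : ℕ => chi a b k t) Filter.atTop (𝓝 1) := by
  refine tendsto_const_nhds.congr' ?_
  obtain ⟨n1, hn1⟩ := exists_nat_gt (2 / (t - a))
  obtain ⟨n2, hn2⟩ := exists_nat_gt (2 / (b - t))
  have h1 : 0 < t - a := by linarith [ht.1]
  have h2 : 0 < b - t := by linarith [ht.2]
  filter_upwards [Filter.eventually_ge_atTop n1, Filter.eventually_ge_atTop n2] with k hk1 hk2
  have hk1' : (n1:ℝ) ≤ k := by exact_mod_cast hk1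
  have hk2' : (n2:ℝ) ≤ k := by exact_mod_cast hk2
  rw [div_lt_iff₀ h1] at hn1
  rw [div_lt_iff₀ h2] at hn2
  have g1 : 1 ≤ ((k:ℝ) + 1) * (t - a) - 1 := by nlinarith
  have g2 : 1 ≤ ((k:ℝ) + 1) * (b - t) - 1 := by nlinarith
  unfold chi
  have q1 : sT (((k:ℝ) + 1) * (t - a) - 1) = 1 := Real.smoothTransition.one_of_one_le g1
  have q2 : sT (((k:ℝ) + 1) * (b - t) - 1) = 1 := Real.smoothTransition.one_of_one_le g2
  rw [q1, q2, mul_one]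

lemma ee_lim {t : ℝ} (ht : t ∈ Ioo a b) : Filter.Tendsto (fun k : ℕ => ee a η k t) Filter.atTop (𝓝 0) := by
  refine tendsto_const_nhds.congr' ?_
  obtain ⟨n1, hn1⟩ := exists_nat_gt (2 / (t - a))
  have h1 : 0 < t - a := by linarith [ht.1]
  filter_upwards [Filter.eventually_ge_atTop n1] with k hk1
  have hk1' : (n1:ℝ) ≤ k := by exact_mod_cast hk1
  rw [div_lt_iff₀ h1] at hn1
  have g1 : 1 < ((k:ℝ) + 1) * (t - a) - 1 := by nlinarith
  unfold ee
  rw [sT_d0 (Or.inr g1)]; simp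

lemma ee_bd (hη : ContDiff ℝ (⊤ : ℕ∞) η) (hη0 : ∀ t, 0 ≤ η t) (ha : η a = 0) :
    ∃ C, ∀ (k : ℕ), ∀ t ∈ Ioo a b, 0 ≤ ee a η k t ∧ ee a η k t ≤ C := by
  have hc : Continuous (deriv η) := hη.continuous_deriv (by simp)
  obtain ⟨L, hL⟩ := (isCompact_Icc (a := a) (b := b)).exists_bound_of_continuousOn hc.continuousOn
  obtain ⟨C, hC0, hC⟩ := sT_bd
  have hLip : ∀ t ∈ Ioo a b, η t ≤ max L 0 * (t - a) := by
    intro t ht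
    have := (convex_Icc a b).norm_image_sub_le_of_norm_deriv_le (f := η) (C := L) (x := a) (y := t)
      (fun x _ => hη.contDiffAt.differentiableAt (by simp)) hL ⟨le_rfl, (ht.1.trans ht.2).le⟩ (Ioo_subset_Icc_self ht)
    rw [ha, sub_zero, Real.norm_eq_abs, Real.norm_eq_abs, abs_of_pos (sub_pos.2 ht.1)] at this
    have h1 : 0 < t - a := sub_pos.2 ht.1
    calc η t ≤ _ := (le_abs_self _).trans this
      _ ≤ _ := by gcongr; exact le_max_left _ _
  refine ⟨max L 0 * C * 2, fun k t ht => ?_⟩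
  have hk : (0:ℝ) < (k:ℝ) + 1 := by positivity
  have h1 : 0 < t - a := sub_pos.2 ht.1
  have c1 := hC (((k:ℝ) + 1) * (t - a) - 1)
  have hL0 : 0 ≤ max L 0 := le_max_right _ _
  unfold ee
  refine ⟨mul_nonneg (hη0 t) (mul_nonneg c1.1 hk.le), ?_⟩
  by_cases hz : 1 < ((k:ℝ) + 1) * (t - a) - 1
  · rw [sT_d0 (Or.inr hz)]; simp; positivity
  · calc η t * (deriv sT (((k:ℝ) + 1) * (t - a) - 1) * ((k:ℝ) + 1)) ≤ (max L 0 * (t - a)) * (C * ((k:ℝ) + 1)) := by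
          have := c1.1
          gcongr
          · exact hLip t ht
          · exact c1.2
      _ = max L 0 * C * (((k:ℝ) + 1) * (t - a)) := by ring
      _ ≤ max L 0 * C * 2 := by gcongr; linarith

lemma ee_cont (hη : ContDiff ℝ (⊤ : ℕ∞) η) : Continuous (ee a η k) := by
  have hc : Continuous (deriv sT) := sT_cd.continuous_deriv (by simp)
  have := hη.continuous
  unfold ee
  fun_prop
end chi

section dat
variable {N : ℕ} {s Λ a b M : ℝ} {x₀ : E N} {R r l m P Q d : ℝ} {ψ : E N → ℝ}
    {u : E N → ℝ → ℝ} {K : E N → E N → ℝ → ℝ} {η : ℝ → ℝ}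

lemma eta_ineq (D : Dat N s Λ a b M x₀ R r l m P Q d ψ u K) (hab : a < b)
    (hη : ContDiff ℝ (⊤ : ℕ∞) η) (hη0 : ∀ t, 0 ≤ η t) (ha : η a = 0)
    {T : ℝ} {Ω : Set (E N)} (hΩ : MeasurableSet Ω) (hsubx : ball x₀ R ⊆ Ω) (hsubt : Ioo a b ⊆ Ioo 0 T)
    (hu : IsWeakSupersolution N T K Ω u) {S1 S2 : ℝ} (hS10 : 0 ≤ S1) (hS20 : 0 ≤ S2)
    (hS1 : ∀ x ∈ tsupport ψ, ∫ y in (ball x₀ r)ᶜ, ‖x - y‖ ^ (-((N : ℝ) + 2 * s)) ≤ S1)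
    (hS2 : ∀ᵐ t ∂(volume.restrict (Ioo a b)), ∀ x ∈ tsupport ψ,
      ∫ y in (ball x₀ R)ᶜ, max (-u y t) 0 * ‖x - y‖ ^ (-((N : ℝ) + 2 * s)) ≤ S2) :
    2 * (m + 1) / m ^ 2 * (∫ t in Ioo a b, It N x₀ r l m ψ u t * η t) ≤
      1 / m * (∫ t in Ioo a b, Y0 N x₀ r l m ψ u t * |deriv η t|) +
      2 * max 4 ((6 * m + 1) / 2) * (∫ t in Ioo a b, Jt N x₀ r l m ψ u K t * η t) +
      2 * Λ * (S1 + S2 / l) * (∫ t in Ioo a b, Y0 N x₀ r l m ψ u t * η t) +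
      (m + 2) ^ 2 / (2 * (m + 1)) * (∫ t in Ioo a b, Pt N x₀ r l m ψ u t * η t) := by
  obtain ⟨mY, CY, hY⟩ := D.Y_ok
  obtain ⟨mJ, CJ, hJ⟩ := D.J_ok
  obtain ⟨mP, CP, hP⟩ := D.P_ok
  have hηc := hη.continuous
  have hη'c : Continuous (deriv η) := hη.continuous_deriv (by simp)
  have hm := D.hm
  have hl := D.hl
  have hΛ := D.hΛ
  have hfin : IsFiniteMeasure ((volume : Measure ℝ).restrict (Ioo a b)) := ⟨by simp⟩
  have iYa := bdd_int mY hY hη'c.abs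
  have iY := bdd_int mY hY hηc
  have iJ := bdd_int mJ hJ hηc
  have iP := bdd_int mP hP hηc
  have nYa : 0 ≤ ∫ t in Ioo a b, Y0 N x₀ r l m ψ u t * |deriv η t| :=
    setIntegral_nonneg measurableSet_Ioo fun t ht => mul_nonneg (hY t ht).1 (abs_nonneg _)
  have nY : 0 ≤ ∫ t in Ioo a b, Y0 N x₀ r l m ψ u t * η t :=
    setIntegral_nonneg measurableSet_Ioo fun t ht => mul_nonneg (hY t ht).1 (hη0 t)
  have nJ : 0 ≤ ∫ t in Ioo a b, Jt N x₀ r l m ψ u K t * η t :=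
    setIntegral_nonneg measurableSet_Ioo fun t ht => mul_nonneg (hJ t ht).1 (hη0 t)
  have nP : 0 ≤ ∫ t in Ioo a b, Pt N x₀ r l m ψ u t * η t :=
    setIntegral_nonneg measurableSet_Ioo fun t ht => mul_nonneg (hP t ht).1 (hη0 t)
  by_cases iI : IntegrableOn (fun t => It N x₀ r l m ψ u t * η t) (Ioo a b)
  swap
  · rw [integral_undef iI]
    have : (0:ℝ) ≤ max 4 ((6 * m + 1) / 2) := le_trans (by norm_num) (le_max_left _ _)
    rw [mul_zero]
    positivity
  have hI0 : ∀ t ∈ Ioo a b, 0 ≤ It N x₀ r l m ψ u t := fun t ht =>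
    setIntegral_nonneg measurableSet_ball fun x hx =>
      mul_nonneg (by positivity) (Real.rpow_nonneg (D.ψok.nn x) _)
  obtain ⟨Ce, hCe⟩ := ee_bd (b := b) hη hη0 ha
  have iE : ∀ k, IntegrableOn (fun t => Y0 N x₀ r l m ψ u t * ee a η k t) (Ioo a b) := fun k =>
    bdd_int mY hY (ee_cont hη)
  -- limits
  have limE : Filter.Tendsto (fun k : ℕ => ∫ t in Ioo a b, Y0 N x₀ r l m ψ u t * ee a η k t) Filter.atTop (𝓝 0) := by
    have := tendsto_integral_of_dominated_convergence (μ := volume.restrict (Ioo a b))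
      (F := fun k t => Y0 N x₀ r l m ψ u t * ee a η k t) (f := fun _ => 0) (fun _ => CY * Ce)
      (fun k => (iE k).aestronglyMeasurable) (integrable_const _) (fun k => by
        filter_upwards [ae_restrict_mem measurableSet_Ioo] with t ht
        rw [Real.norm_eq_abs, abs_of_nonneg (mul_nonneg (hY t ht).1 (hCe k t ht).1)]
        exact mul_le_mul (hY t ht).2 (hCe k t ht).2 (hCe k t ht).1 ((hY t ht).1.trans (hY t ht).2))
      (by
        filter_upwards [ae_restrict_mem measurableSet_Ioo] with t ht
        simpa using (ee_lim (η := η) ht).const_mul (Y0 N x₀ r l m ψ u t))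
    simpa using this
  have limI : Filter.Tendsto (fun k : ℕ => ∫ t in Ioo a b, It N x₀ r l m ψ u t * (η t * chi a b k t)) Filter.atTop
      (𝓝 (∫ t in Ioo a b, It N x₀ r l m ψ u t * η t)) := by
    refine tendsto_integral_of_dominated_convergence (fun t => It N x₀ r l m ψ u t * η t)
      (fun k => ((D.ctsI.fam D.hrR).int (chi_th (a := a) (b := b) (k := k) hη hη0).sm.continuous (chi_th hη hη0).cs (chi_th hη hη0).ts zmem).aestronglyMeasurable)
      iI (fun k => ?_) ?_
    · filter_upwards [ae_restrict_mem measurableSet_Ioo] with t ht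
      have h1 := hI0 t ht
      have h2 := hη0 t
      have h3 := chi_nn (a := a) (b := b) (k := k) t
      rw [Real.norm_eq_abs, abs_of_nonneg (by positivity)]
      exact mul_le_mul_of_nonneg_left (mul_le_of_le_one_right h2 (chi_le t)) h1
    · filter_upwards [ae_restrict_mem measurableSet_Ioo] with t ht
      have := ((chi_lim ht).const_mul (η t)).const_mul (It N x₀ r l m ψ u t)
      simpa using this
  have main : ∀ k : ℕ, 2 * (m + 1) / m ^ 2 * (∫ t in Ioo a b, It N x₀ r l m ψ u t * (η t * chi a b k t)) ≤
      1 / m * ((∫ t in Ioo a b, Y0 N x₀ r l m ψ u t * |deriv η t|) + ∫ t in Ioo a b, Y0 N x₀ r l m ψ u t * ee a η k t) +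
      2 * max 4 ((6 * m + 1) / 2) * (∫ t in Ioo a b, Jt N x₀ r l m ψ u K t * η t) +
      2 * Λ * (S1 + S2 / l) * (∫ t in Ioo a b, Y0 N x₀ r l m ψ u t * η t) +
      (m + 2) ^ 2 / (2 * (m + 1)) * (∫ t in Ioo a b, Pt N x₀ r l m ψ u t * η t) := by
    intro k
    have hθ : Th a b (fun t => η t * chi a b k t) := chi_th hη hη0
    have hθc := hθ.sm.continuous
    have hθ'c : Continuous (deriv (fun t => η t * chi a b k t)) := hθ.sm.continuous_deriv (by simp)
    have hp := per_theta D hab hθ hΩ hsubx hsubt hu hS1 hS2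
    have le1 : ∀ t, η t * chi a b k t ≤ η t := fun t => mul_le_of_le_one_right (hη0 t) (chi_le t)
    have g1 : ∫ t in Ioo a b, Y0 N x₀ r l m ψ u t * deriv (fun t => η t * chi a b k t) t ≤
        (∫ t in Ioo a b, Y0 N x₀ r l m ψ u t * |deriv η t|) + ∫ t in Ioo a b, Y0 N x₀ r l m ψ u t * ee a η k t := by
      rw [← integral_add iYa (iE k)]
      refine setIntegral_mono_on (bdd_int mY hY hθ'c) (iYa.add (iE k)) measurableSet_Ioo fun t ht => ?_
      rw [← mul_add]
      exact mul_le_mul_of_nonneg_left (chi_deriv hη hη0 t) (hY t ht).1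
    have g2 : ∫ t in Ioo a b, Jt N x₀ r l m ψ u K t * (η t * chi a b k t) ≤ ∫ t in Ioo a b, Jt N x₀ r l m ψ u K t * η t :=
      setIntegral_mono_on (bdd_int mJ hJ hθc) iJ measurableSet_Ioo fun t ht => mul_le_mul_of_nonneg_left (le1 t) (hJ t ht).1
    have g3 : ∫ t in Ioo a b, Y0 N x₀ r l m ψ u t * (η t * chi a b k t) ≤ ∫ t in Ioo a b, Y0 N x₀ r l m ψ u t * η t :=
      setIntegral_mono_on (bdd_int mY hY hθc) iY measurableSet_Ioo fun t ht => mul_le_mul_of_nonneg_left (le1 t) (hY t ht).1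
    have g4 : ∫ t in Ioo a b, Pt N x₀ r l m ψ u t * (η t * chi a b k t) ≤ ∫ t in Ioo a b, Pt N x₀ r l m ψ u t * η t :=
      setIntegral_mono_on (bdd_int mP hP hθc) iP measurableSet_Ioo fun t ht => mul_le_mul_of_nonneg_left (le1 t) (hP t ht).1
    refine hp.trans ?_
    gcongr
  have lim2 := ((((limE.const_add (∫ t in Ioo a b, Y0 N x₀ r l m ψ u t * |deriv η t|)).const_mul (1 / m)).add_const
    (2 * max 4 ((6 * m + 1) / 2) * (∫ t in Ioo a b, Jt N x₀ r l m ψ u K t * η t))).add_const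
    (2 * Λ * (S1 + S2 / l) * (∫ t in Ioo a b, Y0 N x₀ r l m ψ u t * η t))).add_const
      ((m + 2) ^ 2 / (2 * (m + 1)) * (∫ t in Ioo a b, Pt N x₀ r l m ψ u t * η t))
  have fin := le_of_tendsto_of_tendsto' (limI.const_mul (2 * (m + 1) / m ^ 2)) lim2 main
  simpa using fin
end dat


lemma final_arith {m l Λ S1 S2 I A J Y Pp C : ℝ} (hm : 0 < m) (hl : 0 < l) (hΛ : 0 ≤ Λ) (h1 : 0 ≤ S1)
    (h2 : 0 ≤ S2) (hA : 0 ≤ A) (hY : 0 ≤ Y) (hP : 0 ≤ Pp)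
    (key : 2 * (m + 1) / m ^ 2 * I ≤ 1 / m * A + 2 * C * J + 2 * Λ * (S1 + S2 / l) * Y
      + (m + 2) ^ 2 / (2 * (m + 1)) * Pp) :
    I ≤ (m ^ 2 * C / (m + 1)) * J + (m ^ 2 / (m + 1)) * (2 * Λ * S1 * Y + (2 * Λ / l) * S2 * Y)
      + (m ^ 2 * (m + 2) ^ 2 / (m + 1) ^ 2) * Pp + (m / (m + 1)) * A := by
  have hc : 0 ≤ m ^ 2 / (2 * (m + 1)) := by positivity
  have k2 := mul_le_mul_of_nonneg_left key hc
  have e1 : m ^ 2 / (2 * (m + 1)) * (2 * (m + 1) / m ^ 2 * I) = I := by field_simp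
  have e2 : m ^ 2 / (2 * (m + 1)) * (1 / m * A + 2 * C * J + 2 * Λ * (S1 + S2 / l) * Y
      + (m + 2) ^ 2 / (2 * (m + 1)) * Pp) =
      (m ^ 2 * C / (m + 1)) * J + (m ^ 2 / (m + 1)) * (2 * Λ * S1 * Y + (2 * Λ / l) * S2 * Y)
      + (m ^ 2 * (m + 2) ^ 2 / (m + 1) ^ 2) * Pp + (m / (m + 1)) * A
      - (m ^ 2 / (m + 1) * (Λ * S1 * Y + Λ / l * S2 * Y)
        + 3 / 4 * (m ^ 2 * (m + 2) ^ 2 / (m + 1) ^ 2) * Pp + 1 / 2 * (m / (m + 1)) * A) := by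
    field_simp
    ring
  have e3 : 0 ≤ m ^ 2 / (m + 1) * (Λ * S1 * Y + Λ / l * S2 * Y)
        + 3 / 4 * (m ^ 2 * (m + 2) ^ 2 / (m + 1) ^ 2) * Pp + 1 / 2 * (m / (m + 1)) * A := by
    positivity
  rw [e1, e2] at k2
  linarith

theorem stmt_8 (N : ℕ) (hN : 2 ≤ N) (s Λ T : ℝ) (hs : s ∈ Set.Ioo (0 : ℝ) 1)
    (hΛ : 1 ≤ Λ) (hT : 0 < T)
    (Ω : Set (E N)) (hΩo : IsOpen Ω) (hΩb : Bornology.IsBounded Ω)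
    (K : E N → E N → ℝ → ℝ) (hK : KernelOK N s Λ T K)
    (u : E N → ℝ → ℝ) (hu : IsWeakSupersolution N T K Ω u)
    (x₀ : E N) (R r τ τ₁ τ₂ l m : ℝ)
    (hτ : 0 < τ) (hτ₁₂ : τ₁ < τ₂)
    (hsubx : Metric.ball x₀ R ⊆ Ω) (hsubt : Set.Ioo (τ₁ - τ) τ₂ ⊆ Set.Ioo 0 T)
    (hupos : ∀ x ∈ Metric.ball x₀ R, ∀ t ∈ Set.Ioo (τ₁ - τ) τ₂, 0 ≤ u x t)
    (hr : 0 < r) (hr1 : r ≤ 1) (hrR : r < R) (hl : 0 < l) (hm : 0 < m)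
    (ψ : E N → ℝ) (hψs : ContDiff ℝ (⊤ : ℕ∞) ψ) (hψc : HasCompactSupport ψ)
    (hψsupp : tsupport ψ ⊆ Metric.ball x₀ r) (hψ0 : ∀ x, 0 ≤ ψ x)
    (η : ℝ → ℝ) (hηs : ContDiff ℝ (⊤ : ℕ∞) η) (hη0 : ∀ t, 0 ≤ η t)
    (hη1 : ∀ t, t ≤ τ₁ - τ → η t = 0) (hη2 : ∀ t, τ₂ ≤ t → η t = 1) :
    (∫ t in Set.Ioo (τ₁ - τ) τ₂, ∫ x in Metric.ball x₀ r,
        ‖gradient (fun y => (u y t + l) ^ (-(m / 2))) x‖ ^ 2 * ψ x ^ (m + 2) * η t) ≤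
      (m ^ 2 * max 4 ((6 * m + 1) / 2) / (m + 1)) *
          (∫ t in Set.Ioo (τ₁ - τ) τ₂, ∫ x in Metric.ball x₀ r, ∫ y in Metric.ball x₀ r,
            (ψ x - ψ y) ^ 2 *
              (ψ x ^ m * (u x t + l) ^ (-m) + ψ y ^ m * (u y t + l) ^ (-m)) * η t * K x y t)
        + (m ^ 2 / (m + 1)) *
            (2 * Λ *
                (⨆ x ∈ tsupport ψ,
                  ∫ y in (Metric.ball x₀ r)ᶜ, ‖x - y‖ ^ (-((N : ℝ) + 2 * s))) *
                (∫ t in Set.Ioo (τ₁ - τ) τ₂, ∫ x in Metric.ball x₀ r,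
                  (u x t + l) ^ (-m) * ψ x ^ (m + 2) * η t)
              + (2 * Λ / l) *
                  essSup
                    (fun t => ⨆ x ∈ tsupport ψ,
                      ∫ y in (Metric.ball x₀ R)ᶜ,
                        uminus N u y t * ‖x - y‖ ^ (-((N : ℝ) + 2 * s)))
                    (volume.restrict (Set.Ioo (τ₁ - τ) τ₂)) *
                  (∫ t in Set.Ioo (τ₁ - τ) τ₂, ∫ x in Metric.ball x₀ r,
                    (u x t + l) ^ (-m) * ψ x ^ (m + 2) * η t))
        + (m ^ 2 * (m + 2) ^ 2 / (m + 1) ^ 2) *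
            (∫ t in Set.Ioo (τ₁ - τ) τ₂, ∫ x in Metric.ball x₀ r,
              ‖gradient ψ x‖ ^ 2 * (u x t + l) ^ (-m) * ψ x ^ m * η t)
        + (m / (m + 1)) *
            (∫ t in Set.Ioo (τ₁ - τ) τ₂, ∫ x in Metric.ball x₀ r,
              (u x t + l) ^ (-m) * ψ x ^ (m + 2) * |deriv η t|) := by
  obtain ⟨um, ⟨M, hM⟩, us, -⟩ := id hu
  obtain ⟨Km, Ks, K01⟩ := hK
  obtain ⟨d, hd, hd1, hdist⟩ := exists_dist N x₀ r ψ hψc hψsupp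
  obtain ⟨P, hP⟩ := hψc.exists_bound_of_continuous hψs.continuous
  obtain ⟨Q, hQ⟩ := ContDiff.lipschitzWith_of_hasCompactSupport hψc hψs (by simp)
  have hok : PsiOK N x₀ r P Q d ψ := {
    cont := hψs.continuous
    nn := hψ0
    le := fun x => (le_abs_self _).trans (hP x)
    lip := fun x y => by
      have := hQ.dist_le_mul x y
      rwa [Real.dist_eq, dist_eq_norm] at this
    Q0 := Q.2
    supp := fun x hx => image_eq_zero_of_notMem_tsupport (fun h => hx (hψsupp h))
    d0 := hd
    d1 := hd1
    dist := hdist }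
  have hΛ0 : 0 ≤ Λ := by linarith
  have D : Dat N s Λ (τ₁ - τ) τ₂ M x₀ R r l m P Q d ψ u K := {
    hN := hN, hs := hs, hΛ := hΛ0, hr := hr, hr1 := hr1, hrR := hrR, hl := hl, hm := hm, um := um
    ub := fun t ht x => hM x t (hsubt ht)
    u0 := fun t ht x hx => hupos x hx t ht
    us := us.mono (prod_mono hsubx hsubt)
    Km := Km
    Ks := Ks
    K0 := fun t ht x y h => le_trans (by positivity) (K01 x y h t (hsubt ht)).1
    K1 := fun t ht x y h => (K01 x y h t (hsubt ht)).2
    ψs := hψs, ψc := hψc, ψsupp := hψsupp, ψok := hok }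
  have hab : τ₁ - τ < τ₂ := by linarith
  obtain ⟨b1, b2, -⟩ := le_biSup' (tsupport ψ)
    (fun x => ∫ y in (ball x₀ r)ᶜ, ‖x - y‖ ^ (-((N : ℝ) + 2 * s))) ((d ^ 2)⁻¹ * ∫ z, kap N s z)
    (fun x _ => integral_nonneg fun y => by positivity)
    (fun x hx => (tail_integrable N hN s hs d hd hd1 x _ measurableSet_ball.compl
      (fun y hy => hdist x hx y hy)).2)
  have hM0 : 0 ≤ M := (abs_nonneg _).trans
    (D.ub ((τ₁ - τ + τ₂) / 2) ⟨by linarith, by linarith⟩ x₀)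
  have hkap0 : 0 ≤ ∫ z, kap N s z := integral_nonneg fun z => kap_nonneg N s z
  have hf : ∀ t ∈ Ioo (τ₁ - τ) τ₂, _ := fun t ht => le_biSup' (tsupport ψ)
    (fun x => ∫ y in (ball x₀ R)ᶜ, uminus N u y t * ‖x - y‖ ^ (-((N : ℝ) + 2 * s)))
    (M * ((d ^ 2)⁻¹ * ∫ z, kap N s z))
    (fun x _ => integral_nonneg fun y => mul_nonneg (le_max_right _ _) (by positivity))
    (fun x hx => (tail_integrable_mul N hN s hs d M hd hd1 x _ measurableSet_ball.compl
      (fun y hy => hdist x hx y (fun h => hy (ball_subset_ball hrR.le h)))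
      (fun y => uminus N u y t)
      (by
        have h1 : Measurable fun y : E N => u y t := um.comp (by fun_prop : Measurable fun x : E N => (x, t))
        exact h1.neg.max measurable_const)
      (fun y => by
        have h1 := D.ub t ht y
        rw [abs_le] at h1
        rw [abs_of_nonneg (le_max_right _ _)]
        exact max_le (by linarith) hM0)).2)
  set f : ℝ → ℝ := fun t => ⨆ x ∈ tsupport ψ, ∫ y in (ball x₀ R)ᶜ,
    uminus N u y t * ‖x - y‖ ^ (-((N : ℝ) + 2 * s)) with hfdef
  have hC0 : 0 ≤ M * ((d ^ 2)⁻¹ * ∫ z, kap N s z) := by positivity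
  have hfC : ∀ᵐ t ∂(volume.restrict (Ioo (τ₁ - τ) τ₂)), f t ≤ M * ((d ^ 2)⁻¹ * ∫ z, kap N s z) :=
    (ae_restrict_iff' measurableSet_Ioo).2 (ae_of_all _ fun t ht => (hf t ht).2.2 hC0)
  have hess : ∀ᵐ t ∂(volume.restrict (Ioo (τ₁ - τ) τ₂)),
      f t ≤ essSup f (volume.restrict (Ioo (τ₁ - τ) τ₂)) :=
    ae_le_essSup (Filter.isBoundedUnder_of_eventually_le hfC)
  have hmem : ∀ᵐ t ∂(volume.restrict (Ioo (τ₁ - τ) τ₂)), t ∈ Ioo (τ₁ - τ) τ₂ :=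
    ae_restrict_mem measurableSet_Ioo
  have hne : (ae (volume.restrict (Ioo (τ₁ - τ) τ₂))).NeBot := by
    rw [ae_neBot, Ne, Measure.restrict_eq_zero, Real.volume_Ioo]
    simp [hab]
  have hS20 : 0 ≤ essSup f (volume.restrict (Ioo (τ₁ - τ) τ₂)) := by
    obtain ⟨t, h1, h2⟩ := (hess.and hmem).exists
    exact (hf t h2).2.1.trans h1
  have hS2 : ∀ᵐ t ∂(volume.restrict (Ioo (τ₁ - τ) τ₂)), ∀ x ∈ tsupport ψ,
      ∫ y in (ball x₀ R)ᶜ, max (-u y t) 0 * ‖x - y‖ ^ (-((N : ℝ) + 2 * s)) ≤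
        essSup f (volume.restrict (Ioo (τ₁ - τ) τ₂)) := by
    filter_upwards [hess, hmem] with t h1 h2 x hx
    exact ((hf t h2).1 x hx).trans h1
  have key := eta_ineq D hab hηs hη0 (hη1 _ le_rfl) hΩo.measurableSet hsubx hsubt hu b2 hS20 b1 hS2
  have eI : (∫ t in Ioo (τ₁ - τ) τ₂, ∫ x in ball x₀ r,
        ‖gradient (fun y => (u y t + l) ^ (-(m / 2))) x‖ ^ 2 * ψ x ^ (m + 2) * η t) =
      ∫ t in Ioo (τ₁ - τ) τ₂, It N x₀ r l m ψ u t * η t := by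
    congr 1; ext t; rw [integral_mul_const]; rfl
  have eY : (∫ t in Ioo (τ₁ - τ) τ₂, ∫ x in ball x₀ r,
        (u x t + l) ^ (-m) * ψ x ^ (m + 2) * η t) =
      ∫ t in Ioo (τ₁ - τ) τ₂, Y0 N x₀ r l m ψ u t * η t := by
    congr 1; ext t; rw [integral_mul_const]; rfl
  have eYa : (∫ t in Ioo (τ₁ - τ) τ₂, ∫ x in ball x₀ r,
        (u x t + l) ^ (-m) * ψ x ^ (m + 2) * |deriv η t|) =
      ∫ t in Ioo (τ₁ - τ) τ₂, Y0 N x₀ r l m ψ u t * |deriv η t| := by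
    congr 1; ext t; rw [integral_mul_const]; rfl
  have eP : (∫ t in Ioo (τ₁ - τ) τ₂, ∫ x in ball x₀ r,
        ‖gradient ψ x‖ ^ 2 * (u x t + l) ^ (-m) * ψ x ^ m * η t) =
      ∫ t in Ioo (τ₁ - τ) τ₂, Pt N x₀ r l m ψ u t * η t := by
    congr 1; ext t; rw [integral_mul_const]; rfl
  have eJ : (∫ t in Ioo (τ₁ - τ) τ₂, ∫ x in ball x₀ r, ∫ y in ball x₀ r,
        (ψ x - ψ y) ^ 2 *
          (ψ x ^ m * (u x t + l) ^ (-m) + ψ y ^ m * (u y t + l) ^ (-m)) * η t * K x y t) =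
      ∫ t in Ioo (τ₁ - τ) τ₂, Jt N x₀ r l m ψ u K t * η t := by
    congr 1; ext t
    unfold Jt
    rw [← integral_mul_const]
    congr 1; ext x
    rw [← integral_mul_const]
    congr 1; ext y
    unfold Jint
    ring
  rw [eI, eY, eYa, eP, eJ]
  obtain ⟨-, CY, hY⟩ := D.Y_ok
  obtain ⟨-, CJ, hJ⟩ := D.J_ok
  obtain ⟨-, CP, hPt⟩ := D.P_ok
  have nYa : 0 ≤ ∫ t in Ioo (τ₁ - τ) τ₂, Y0 N x₀ r l m ψ u t * |deriv η t| :=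
    setIntegral_nonneg measurableSet_Ioo fun t ht => mul_nonneg (hY t ht).1 (abs_nonneg _)
  have nY : 0 ≤ ∫ t in Ioo (τ₁ - τ) τ₂, Y0 N x₀ r l m ψ u t * η t :=
    setIntegral_nonneg measurableSet_Ioo fun t ht => mul_nonneg (hY t ht).1 (hη0 t)
  have nP : 0 ≤ ∫ t in Ioo (τ₁ - τ) τ₂, Pt N x₀ r l m ψ u t * η t :=
    setIntegral_nonneg measurableSet_Ioo fun t ht => mul_nonneg (hPt t ht).1 (hη0 t)
  exact final_arith hm hl hΛ0 b2 hS20 nYa nY nP key
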